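/- arXiv:1504.00520 — 7 statements merged into one kernel-verified Lean document; each statement's English description precedes it below -/
import Mathlib

section
/- Let H be a hyper-ideal of multilinear operators between Banach spaces. Define the class H̄ componentwise by letting H̄(E1,…,En;F) be the closure of H(E1,…,En;F) in the operator norm of L(E1,…,En;F). Then H̄, equipped with the operator norm, is the smallest closed hyper-ideal containing H: H̄ is a closed hyper-ideal, H ⊆ H̄, and every closed hyper-ideal containing H contains H̄. -/
open Filter Topology
open scoped ENNReal NNReal BigOperators

noncomputable section

/-- The type of classes of continuous multilinear operators between Banach spaces:
one set of continuous `n`-linear operators for each `n` and each tuple of Banach spaces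
`E₁, …, Eₙ, F` over `𝕜`. -/
abbrev MultiClass (𝕜 : Type) [RCLike 𝕜] : Type 1 :=
  ∀ (n : ℕ) (E : Fin n → Type) [∀ i, NormedAddCommGroup (E i)] [∀ i, NormedSpace 𝕜 (E i)]
    [∀ i, CompleteSpace (E i)]
    (F : Type) [NormedAddCommGroup F] [NormedSpace 𝕜 F] [CompleteSpace F],
    Set (ContinuousMultilinearMap 𝕜 E F)

/-- A real-valued "norm" function defined on all continuous multilinear operators
between Banach spaces. -/
abbrev MultiNorm (𝕜 : Type) [RCLike 𝕜] : Type 1 :=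
  ∀ (n : ℕ) (E : Fin n → Type) [∀ i, NormedAddCommGroup (E i)] [∀ i, NormedSpace 𝕜 (E i)]
    [∀ i, CompleteSpace (E i)]
    (F : Type) [NormedAddCommGroup F] [NormedSpace 𝕜 F] [CompleteSpace F],
    ContinuousMultilinearMap 𝕜 E F → ℝ

variable (𝕜 : Type) [RCLike 𝕜]

/-- The finite type multilinear operators: the linear span of the operators
`(x₁,…,xₙ) ↦ φ₁(x₁)⋯φₙ(xₙ) • y` with `φᵢ ∈ Eᵢ'`, `y ∈ F`. -/
def IsFiniteType {n : ℕ} {E : Fin n → Type} [∀ i, NormedAddCommGroup (E i)]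
    [∀ i, NormedSpace 𝕜 (E i)] {F : Type} [NormedAddCommGroup F] [NormedSpace 𝕜 F]
    (A : ContinuousMultilinearMap 𝕜 E F) : Prop :=
  A ∈ Submodule.span 𝕜 {B : ContinuousMultilinearMap 𝕜 E F |
      ∃ (φ : ∀ i, E i →L[𝕜] 𝕜) (y : F), ∀ x, B x = (∏ i, φ i (x i)) • y}

/-- A multilinear operator has finite rank if its range spans a finite-dimensional
subspace of the target space. -/
def IsFiniteRank {n : ℕ} {E : Fin n → Type} [∀ i, NormedAddCommGroup (E i)]
    [∀ i, NormedSpace 𝕜 (E i)] {F : Type} [NormedAddCommGroup F] [NormedSpace 𝕜 F]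
    (A : ContinuousMultilinearMap 𝕜 E F) : Prop :=
  FiniteDimensional 𝕜 (Submodule.span 𝕜 (Set.range (⇑A)))

/-- `IsBlockComp 𝕜 f B A t C` says that `C = t ∘ A ∘ (B₁,…,Bₙ)`, where the blocks of
variables `(G₁,…,G_{m₁}), (G_{m₁+1},…,G_{m₂}), …` are the fibers of the monotone
surjection `f : Fin M → Fin n` (this encodes naturals `1 ≤ m₁ < ⋯ < mₙ = M`). -/
def IsBlockComp {n M : ℕ} {G : Fin M → Type} [∀ j, NormedAddCommGroup (G j)]
    [∀ j, NormedSpace 𝕜 (G j)] {E : Fin n → Type} [∀ i, NormedAddCommGroup (E i)]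
    [∀ i, NormedSpace 𝕜 (E i)] {F H0 : Type} [NormedAddCommGroup F] [NormedSpace 𝕜 F]
    [NormedAddCommGroup H0] [NormedSpace 𝕜 H0]
    (f : Fin M → Fin n)
    (B : ∀ i : Fin n, ContinuousMultilinearMap 𝕜 (fun j : {j : Fin M // f j = i} => G j.1) (E i))
    (A : ContinuousMultilinearMap 𝕜 E F) (t : F →L[𝕜] H0)
    (C : ContinuousMultilinearMap 𝕜 G H0) : Prop :=
  ∀ x : ∀ j, G j, C x = t (A fun i => B i fun j => x j.1)

/-- All the hyper-ideal axioms except for the containment of the finite type operators: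
each component is a linear subspace, and the class enjoys the hyper-ideal property. -/
structure IsHyperIdealCore (H : MultiClass 𝕜) : Prop where
  zero_mem : ∀ (n : ℕ) (E : Fin n → Type) [∀ i, NormedAddCommGroup (E i)]
      [∀ i, NormedSpace 𝕜 (E i)] [∀ i, CompleteSpace (E i)]
      (F : Type) [NormedAddCommGroup F] [NormedSpace 𝕜 F] [CompleteSpace F],
      (0 : ContinuousMultilinearMap 𝕜 E F) ∈ H n E F
  add_mem : ∀ (n : ℕ) (E : Fin n → Type) [∀ i, NormedAddCommGroup (E i)]
      [∀ i, NormedSpace 𝕜 (E i)] [∀ i, CompleteSpace (E i)]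
      (F : Type) [NormedAddCommGroup F] [NormedSpace 𝕜 F] [CompleteSpace F]
      {A B : ContinuousMultilinearMap 𝕜 E F},
      A ∈ H n E F → B ∈ H n E F → A + B ∈ H n E F
  smul_mem : ∀ (n : ℕ) (E : Fin n → Type) [∀ i, NormedAddCommGroup (E i)]
      [∀ i, NormedSpace 𝕜 (E i)] [∀ i, CompleteSpace (E i)]
      (F : Type) [NormedAddCommGroup F] [NormedSpace 𝕜 F] [CompleteSpace F]
      (c : 𝕜) {A : ContinuousMultilinearMap 𝕜 E F},
      A ∈ H n E F → c • A ∈ H n E F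
  comp_mem : ∀ (n M : ℕ) (G : Fin M → Type) [∀ j, NormedAddCommGroup (G j)]
      [∀ j, NormedSpace 𝕜 (G j)] [∀ j, CompleteSpace (G j)]
      (E : Fin n → Type) [∀ i, NormedAddCommGroup (E i)] [∀ i, NormedSpace 𝕜 (E i)]
      [∀ i, CompleteSpace (E i)]
      (F H0 : Type) [NormedAddCommGroup F] [NormedSpace 𝕜 F] [CompleteSpace F]
      [NormedAddCommGroup H0] [NormedSpace 𝕜 H0] [CompleteSpace H0]
      (f : Fin M → Fin n), Monotone f → Function.Surjective f →
      ∀ (B : ∀ i : Fin n, ContinuousMultilinearMap 𝕜 (fun j : {j : Fin M // f j = i} => G j.1) (E i))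
        (A : ContinuousMultilinearMap 𝕜 E F), A ∈ H n E F →
      ∀ (t : F →L[𝕜] H0) (C : ContinuousMultilinearMap 𝕜 G H0),
        IsBlockComp 𝕜 f B A t C → C ∈ H M G H0

/-- A hyper-ideal of multilinear operators. -/
structure IsHyperIdeal (H : MultiClass 𝕜) extends IsHyperIdealCore 𝕜 H : Prop where
  finiteType_mem : ∀ (n : ℕ) (E : Fin n → Type) [∀ i, NormedAddCommGroup (E i)]
      [∀ i, NormedSpace 𝕜 (E i)] [∀ i, CompleteSpace (E i)]
      (F : Type) [NormedAddCommGroup F] [NormedSpace 𝕜 F] [CompleteSpace F]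
      (A : ContinuousMultilinearMap 𝕜 E F), IsFiniteType 𝕜 A → A ∈ H n E F

/-- A `p`-normed hyper-ideal `(H, N)`. -/
structure IsPNormedHyperIdeal (H : MultiClass 𝕜) (N : MultiNorm 𝕜) (p : ℝ)
    extends IsHyperIdeal 𝕜 H : Prop where
  p_pos : 0 < p
  p_le_one : p ≤ 1
  norm_nonneg' : ∀ (n : ℕ) (E : Fin n → Type) [∀ i, NormedAddCommGroup (E i)]
      [∀ i, NormedSpace 𝕜 (E i)] [∀ i, CompleteSpace (E i)]
      (F : Type) [NormedAddCommGroup F] [NormedSpace 𝕜 F] [CompleteSpace F]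
      (A : ContinuousMultilinearMap 𝕜 E F), 0 ≤ N n E F A
  norm_eq_zero_iff : ∀ (n : ℕ) (E : Fin n → Type) [∀ i, NormedAddCommGroup (E i)]
      [∀ i, NormedSpace 𝕜 (E i)] [∀ i, CompleteSpace (E i)]
      (F : Type) [NormedAddCommGroup F] [NormedSpace 𝕜 F] [CompleteSpace F]
      {A : ContinuousMultilinearMap 𝕜 E F}, A ∈ H n E F → (N n E F A = 0 ↔ A = 0)
  norm_smul : ∀ (n : ℕ) (E : Fin n → Type) [∀ i, NormedAddCommGroup (E i)]
      [∀ i, NormedSpace 𝕜 (E i)] [∀ i, CompleteSpace (E i)]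
      (F : Type) [NormedAddCommGroup F] [NormedSpace 𝕜 F] [CompleteSpace F]
      (c : 𝕜) {A : ContinuousMultilinearMap 𝕜 E F}, A ∈ H n E F →
      N n E F (c • A) = ‖c‖ * N n E F A
  norm_add_le : ∀ (n : ℕ) (E : Fin n → Type) [∀ i, NormedAddCommGroup (E i)]
      [∀ i, NormedSpace 𝕜 (E i)] [∀ i, CompleteSpace (E i)]
      (F : Type) [NormedAddCommGroup F] [NormedSpace 𝕜 F] [CompleteSpace F]
      {A B : ContinuousMultilinearMap 𝕜 E F}, A ∈ H n E F → B ∈ H n E F →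
      N n E F (A + B) ^ p ≤ N n E F A ^ p + N n E F B ^ p
  norm_In : ∀ n : ℕ,
      N n (fun _ => 𝕜) 𝕜 (ContinuousMultilinearMap.mkPiAlgebra 𝕜 (Fin n) 𝕜) = 1
  norm_comp_le : ∀ (n M : ℕ) (G : Fin M → Type) [∀ j, NormedAddCommGroup (G j)]
      [∀ j, NormedSpace 𝕜 (G j)] [∀ j, CompleteSpace (G j)]
      (E : Fin n → Type) [∀ i, NormedAddCommGroup (E i)] [∀ i, NormedSpace 𝕜 (E i)]
      [∀ i, CompleteSpace (E i)]
      (F H0 : Type) [NormedAddCommGroup F] [NormedSpace 𝕜 F] [CompleteSpace F]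
      [NormedAddCommGroup H0] [NormedSpace 𝕜 H0] [CompleteSpace H0]
      (f : Fin M → Fin n), Monotone f → Function.Surjective f →
      ∀ (B : ∀ i : Fin n, ContinuousMultilinearMap 𝕜 (fun j : {j : Fin M // f j = i} => G j.1) (E i))
        (A : ContinuousMultilinearMap 𝕜 E F), A ∈ H n E F →
      ∀ (t : F →L[𝕜] H0) (C : ContinuousMultilinearMap 𝕜 G H0),
        IsBlockComp 𝕜 f B A t C →
        N M G H0 C ≤ ‖t‖ * N n E F A * ∏ i, ‖B i‖

/-- A `p`-Banach hyper-ideal: a `p`-normed hyper-ideal each of whose components is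
complete in the topology generated by the `p`-norm `N`. -/
structure IsPBanachHyperIdeal (H : MultiClass 𝕜) (N : MultiNorm 𝕜) (p : ℝ)
    extends IsPNormedHyperIdeal 𝕜 H N p : Prop where
  complete : ∀ (n : ℕ) (E : Fin n → Type) [∀ i, NormedAddCommGroup (E i)]
      [∀ i, NormedSpace 𝕜 (E i)] [∀ i, CompleteSpace (E i)]
      (F : Type) [NormedAddCommGroup F] [NormedSpace 𝕜 F] [CompleteSpace F]
      (u : ℕ → ContinuousMultilinearMap 𝕜 E F), (∀ k, u k ∈ H n E F) →
      (∀ ε : ℝ, 0 < ε → ∃ K : ℕ, ∀ k ≥ K, ∀ l ≥ K, N n E F (u k - u l) < ε) →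
      ∃ A ∈ H n E F, Tendsto (fun k => N n E F (u k - A)) atTop (𝓝 0)

/-- The uniform (operator) norm, as a `MultiNorm`. -/
def opMultiNorm : MultiNorm 𝕜 := by
  intro n E _ _ _ F _ _ _
  exact fun A => ‖A‖

/-- The componentwise operator-norm closure of a class. -/
def closureClass (H : MultiClass 𝕜) : MultiClass 𝕜 := by
  intro n E _ _ _ F _ _ _
  exact closure (H n E F)

section BlockComp

variable {ι κ : Type*} [DecidableEq ι]
  {G : κ → Type*} [∀ j, NormedAddCommGroup (G j)] [∀ j, NormedSpace 𝕜 (G j)]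
  {E : ι → Type*} [∀ i, NormedAddCommGroup (E i)] [∀ i, NormedSpace 𝕜 (E i)]
  {F F' : Type*} [NormedAddCommGroup F] [NormedSpace 𝕜 F]
  [NormedAddCommGroup F'] [NormedSpace 𝕜 F']

/-- Changing the variable `j` only changes the block containing `j`. -/
theorem block_update [DecidableEq κ] (f : κ → ι)
    (B : ∀ i, ContinuousMultilinearMap 𝕜 (fun j : {j // f j = i} => G j.1) (E i))
    (x : ∀ j, G j) (j : κ) (y : G j) :
    (fun i => B i fun k => Function.update x j y k.1) =
      Function.update (fun i => B i fun k => x k.1) (f j)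
        (B (f j) (Function.update (fun k : {k // f k = f j} => x k.1) ⟨j, rfl⟩ y)) := by
  funext i
  by_cases h : i = f j
  · subst h
    rw [Function.update_self]
    congr 1
    funext k
    by_cases hk : k = ⟨j, rfl⟩
    · subst hk
      simp
    · rw [Function.update_of_ne hk, Function.update_of_ne fun e => hk (Subtype.ext e)]
  · rw [Function.update_of_ne h]
    congr 1
    funext k
    exact Function.update_of_ne (fun e => h (by rw [← k.2, e])) _ _

/-- The composition `t ∘ A ∘ (B i)ᵢ`, where `B i` takes the variables in the fiber of `f`
over `i`. -/
def blockComp (f : κ → ι)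
    (B : ∀ i, ContinuousMultilinearMap 𝕜 (fun j : {j // f j = i} => G j.1) (E i))
    (t : F →L[𝕜] F') (A : ContinuousMultilinearMap 𝕜 E F) :
    ContinuousMultilinearMap 𝕜 G F' where
  toFun x := t (A fun i => B i fun j => x j.1)
  map_update_add' x j y z := by
    simp only [block_update, ContinuousMultilinearMap.map_update_add, map_add]
  map_update_smul' x j c y := by
    simp only [block_update, ContinuousMultilinearMap.map_update_smul, map_smul]
  cont := by
    refine t.continuous.comp (A.cont.comp (continuous_pi fun i => (B i).cont.comp ?_))
    fun_prop

@[simp]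
theorem blockComp_apply (f : κ → ι)
    (B : ∀ i, ContinuousMultilinearMap 𝕜 (fun j : {j // f j = i} => G j.1) (E i))
    (t : F →L[𝕜] F') (A : ContinuousMultilinearMap 𝕜 E F) (x : ∀ j, G j) :
    blockComp 𝕜 f B t A x = t (A fun i => B i fun j => x j.1) :=
  rfl

variable [Fintype ι] [Fintype κ]

theorem norm_blockComp_le (f : κ → ι)
    (B : ∀ i, ContinuousMultilinearMap 𝕜 (fun j : {j // f j = i} => G j.1) (E i))
    (t : F →L[𝕜] F') (A : ContinuousMultilinearMap 𝕜 E F) :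
    ‖blockComp 𝕜 f B t A‖ ≤ (‖t‖ * ∏ i, ‖B i‖) * ‖A‖ := by
  refine ContinuousMultilinearMap.opNorm_le_bound (by positivity) fun x => ?_
  have hfib : ∏ i, ∏ j : {j // f j = i}, ‖x j.1‖ = ∏ j, ‖x j‖ :=
    Fintype.prod_fiberwise f fun j => ‖x j‖
  calc ‖t (A fun i => B i fun j => x j.1)‖
      ≤ ‖t‖ * (‖A‖ * ∏ i, ‖B i fun j => x j.1‖) :=
        (t.le_opNorm _).trans (by gcongr; exact A.le_opNorm _)
    _ ≤ ‖t‖ * (‖A‖ * ∏ i, (‖B i‖ * ∏ j : {j // f j = i}, ‖x j.1‖)) := by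
        gcongr with i
        exact (B i).le_opNorm _
    _ = (‖t‖ * ∏ i, ‖B i‖) * ‖A‖ * ∏ j, ‖x j‖ := by
        rw [Finset.prod_mul_distrib, hfib]
        ring

theorem continuous_blockComp (f : κ → ι)
    (B : ∀ i, ContinuousMultilinearMap 𝕜 (fun j : {j // f j = i} => G j.1) (E i))
    (t : F →L[𝕜] F') :
    Continuous fun A : ContinuousMultilinearMap 𝕜 E F => blockComp 𝕜 f B t A :=
  (LinearMap.mkContinuous
    { toFun := fun A => blockComp 𝕜 f B t A
      map_add' := fun A A' => by ext x; simp
      map_smul' := fun c A => by ext x; simp :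
      ContinuousMultilinearMap 𝕜 E F →ₗ[𝕜] ContinuousMultilinearMap 𝕜 G F' }
    _ (norm_blockComp_le 𝕜 f B t)).continuous

end BlockComp

theorem isHyperIdeal_closureClass {H : MultiClass 𝕜} (hH : IsHyperIdeal 𝕜 H) :
    IsHyperIdeal 𝕜 (closureClass 𝕜 H) where
  zero_mem n E _ _ _ F _ _ _ := subset_closure (hH.zero_mem n E F)
  add_mem n E _ _ _ F _ _ _ _ _ hA hB :=
    map_mem_closure₂ continuous_add hA hB fun _ hA' _ hB' => hH.add_mem n E F hA' hB'
  smul_mem n E _ _ _ F _ _ _ c _ hA :=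
    map_mem_closure (continuous_const_smul c) hA fun _ hA' => hH.smul_mem n E F c hA'
  comp_mem n M G _ _ _ E _ _ _ F H0 _ _ _ _ _ _ f hf hs B A hA t C hC := by
    obtain rfl : C = blockComp 𝕜 f B t A := ContinuousMultilinearMap.ext hC
    exact map_mem_closure (continuous_blockComp 𝕜 f B t) hA fun A' hA' =>
      hH.comp_mem n M G E F H0 f hf hs B A' hA' t _ fun _ => rfl
  finiteType_mem n E _ _ _ F _ _ _ A hA := subset_closure (hH.finiteType_mem n E F A hA)

/-- If `H` is a hyper-ideal then its componentwise operator-norm closure `H̄` is the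
smallest closed hyper-ideal containing `H`. -/
theorem closureClass_isSmallest_closedHyperIdeal (H : MultiClass 𝕜)
    (hH : IsHyperIdeal 𝕜 H) :
    (IsHyperIdeal 𝕜 (closureClass 𝕜 H) ∧
      ∀ (n : ℕ) (E : Fin n → Type) [∀ i, NormedAddCommGroup (E i)]
      [∀ i, NormedSpace 𝕜 (E i)] [∀ i, CompleteSpace (E i)]
      (F : Type) [NormedAddCommGroup F] [NormedSpace 𝕜 F] [CompleteSpace F],
        IsClosed (closureClass 𝕜 H n E F)) ∧
    (∀ (n : ℕ) (E : Fin n → Type) [∀ i, NormedAddCommGroup (E i)]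
      [∀ i, NormedSpace 𝕜 (E i)] [∀ i, CompleteSpace (E i)]
      (F : Type) [NormedAddCommGroup F] [NormedSpace 𝕜 F] [CompleteSpace F],
        H n E F ⊆ closureClass 𝕜 H n E F) ∧
    (∀ K : MultiClass 𝕜, IsHyperIdeal 𝕜 K →
      (∀ (n : ℕ) (E : Fin n → Type) [∀ i, NormedAddCommGroup (E i)]
      [∀ i, NormedSpace 𝕜 (E i)] [∀ i, CompleteSpace (E i)]
      (F : Type) [NormedAddCommGroup F] [NormedSpace 𝕜 F] [CompleteSpace F],
        IsClosed (K n E F)) →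
      (∀ (n : ℕ) (E : Fin n → Type) [∀ i, NormedAddCommGroup (E i)]
      [∀ i, NormedSpace 𝕜 (E i)] [∀ i, CompleteSpace (E i)]
      (F : Type) [NormedAddCommGroup F] [NormedSpace 𝕜 F] [CompleteSpace F],
        H n E F ⊆ K n E F) →
      ∀ (n : ℕ) (E : Fin n → Type) [∀ i, NormedAddCommGroup (E i)]
      [∀ i, NormedSpace 𝕜 (E i)] [∀ i, CompleteSpace (E i)]
      (F : Type) [NormedAddCommGroup F] [NormedSpace 𝕜 F] [CompleteSpace F],
        closureClass 𝕜 H n E F ⊆ K n E F) := by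
  refine ⟨⟨isHyperIdeal_closureClass 𝕜 hH, ?_⟩, ?_, ?_⟩
  · intro n E _ _ _ F _ _ _
    exact isClosed_closure
  · intro n E _ _ _ F _ _ _
    exact subset_closure
  · intro K _ hK hHK n E _ _ _ F _ _ _
    exact closure_minimal (hHK n E F) (hK n E F)

end
end

section
/- Let (H,‖·‖_H) be a quasi-normed hyper-ideal, let n and 1 ≤ m1 < ⋯ < mn be natural numbers, let T1 ∈ L(E1,…,E_{m1}), …, Tn ∈ L(E_{m_{n-1}+1},…,E_{mn}) be continuous multilinear forms and y ∈ F. Define the continuous m_n-linear operator T1⊗⋯⊗Tn⊗y : E1×⋯×E_{mn} → F by (x1,…,x_{mn}) ↦ T1(x1,…,x_{m1})⋯Tn(x_{m_{n-1}+1},…,x_{mn})·y. Then T1⊗⋯⊗Tn⊗y ∈ H(E1,…,E_{mn};F) and ‖T1⊗⋯⊗Tn⊗y‖_H = ‖T1⊗⋯⊗Tn⊗y‖ = ‖T1‖⋯‖Tn‖·‖y‖. -/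
open Filter Topology
open scoped ENNReal NNReal BigOperators

noncomputable section

variable (𝕜 : Type) [RCLike 𝕜]

/-- Multiplication of scalars `Iₙ(λ₁,…,λₙ) = λ₁⋯λₙ` belongs to every hyper-ideal. -/
theorem IsHyperIdeal.mkPiAlgebra_mem {H : MultiClass 𝕜} (hH : IsHyperIdeal 𝕜 H) (n : ℕ) :
    ContinuousMultilinearMap.mkPiAlgebra 𝕜 (Fin n) 𝕜 ∈ H n (fun _ => 𝕜) 𝕜 :=
  hH.finiteType_mem n (fun _ => 𝕜) 𝕜 _ <| Submodule.subset_span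
    ⟨fun _ => ContinuousLinearMap.id 𝕜 𝕜, 1, fun x => by simp⟩

/-- The norm of a quasi-normed hyper-ideal dominates the operator norm. -/
theorem IsPNormedHyperIdeal.opNorm_le {H : MultiClass 𝕜} {Nm : MultiNorm 𝕜} {p : ℝ}
    (hH : IsPNormedHyperIdeal 𝕜 H Nm p) {M : ℕ} {E : Fin M → Type}
    [∀ j, NormedAddCommGroup (E j)] [∀ j, NormedSpace 𝕜 (E j)] [∀ j, CompleteSpace (E j)]
    {F : Type} [NormedAddCommGroup F] [NormedSpace 𝕜 F] [CompleteSpace F]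
    {A : ContinuousMultilinearMap 𝕜 E F} (hA : A ∈ H M E F) : ‖A‖ ≤ Nm M E F A := by
  have hN := hH.norm_nonneg' M E F A
  refine A.opNorm_le_bound hN fun x => ?_
  obtain ⟨φ, hφ, hφx⟩ := exists_dual_vector'' 𝕜 (A x)
  let B : ∀ i : Fin M, ContinuousMultilinearMap 𝕜 (fun _ : {j : Fin M // id j = i} => 𝕜) (E i) :=
    fun i => (ContinuousMultilinearMap.mkPiAlgebra 𝕜 {j : Fin M // id j = i} 𝕜).smulRight (x i)
  have hB : ∀ i, ‖B i‖ = ‖x i‖ := fun i => by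
    simp [B, ContinuousMultilinearMap.norm_smulRight]
  let I := ContinuousMultilinearMap.mkPiAlgebra 𝕜 (Fin M) 𝕜
  have hcomp : IsBlockComp 𝕜 id B A φ ((‖A x‖ : 𝕜) • I) := by
    intro c
    have hBc : (fun i => B i fun j => c j.1) = fun i => c i • x i := by
      funext i
      have : ∏ j : {j : Fin M // id j = i}, c j.1 = c i :=
        Fintype.prod_eq_single (⟨i, rfl⟩ : {j : Fin M // id j = i})
          fun j hj => absurd (Subtype.ext j.2) hj
      simp only [B, ContinuousMultilinearMap.smulRight_apply,
        ContinuousMultilinearMap.mkPiAlgebra_apply, this]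
    rw [hBc, A.map_smul_univ, map_smul, hφx]
    simp [I, mul_comm]
  have key := hH.norm_comp_le M M (fun _ => 𝕜) E F 𝕜 id monotone_id Function.surjective_id
    B A hA φ _ hcomp
  rw [hH.norm_smul M (fun _ => 𝕜) 𝕜 _ (IsHyperIdeal.mkPiAlgebra_mem 𝕜 hH.toIsHyperIdeal M),
    hH.norm_In, Finset.prod_congr rfl fun i _ => hB i] at key
  calc ‖A x‖ ≤ ‖φ‖ * Nm M E F A * ∏ i, ‖x i‖ := by simpa using key
    _ ≤ 1 * Nm M E F A * ∏ i, ‖x i‖ := by gcongr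
    _ = Nm M E F A * ∏ i, ‖x i‖ := by rw [one_mul]

/-- A nonzero multilinear operator almost attains its norm at a point with nonzero coordinates. -/
theorem exists_mul_opNorm_mul_prod_lt {ι : Type} [Fintype ι] {E : ι → Type}
    [∀ j, NormedAddCommGroup (E j)] [∀ j, NormedSpace 𝕜 (E j)]
    {F : Type} [NormedAddCommGroup F] [NormedSpace 𝕜 F]
    (T : ContinuousMultilinearMap 𝕜 E F) (hT : T ≠ 0) {c : ℝ} (hc0 : 0 ≤ c) (hc1 : c < 1) :
    ∃ x : ∀ j, E j, (∀ j, x j ≠ 0) ∧ c * ‖T‖ * ∏ j, ‖x j‖ < ‖T x‖ := by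
  by_contra! h
  have hle : ‖T‖ ≤ c * ‖T‖ := by
    refine T.opNorm_le_bound (by positivity) fun x => ?_
    by_cases hx : ∀ j, x j ≠ 0
    · exact h x hx
    · push Not at hx
      obtain ⟨j, hj⟩ := hx
      rw [T.map_coord_zero j hj, norm_zero]
      positivity
  have := norm_pos_iff.2 hT
  nlinarith

/-- The operator norm of `T₁ ⊗ ⋯ ⊗ Tₙ ⊗ y` is at least `‖T₁‖⋯‖Tₙ‖·‖y‖`. -/
theorem prod_opNorm_mul_norm_le {ι κ : Type} [Fintype ι] [Fintype κ] [DecidableEq κ]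
    {E : ι → Type}
    [∀ j, NormedAddCommGroup (E j)] [∀ j, NormedSpace 𝕜 (E j)]
    {F : Type} [NormedAddCommGroup F] [NormedSpace 𝕜 F] (f : ι → κ)
    (T : ∀ i : κ, ContinuousMultilinearMap 𝕜 (fun j : {j : ι // f j = i} => E j.1) 𝕜)
    (y : F) (D : ContinuousMultilinearMap 𝕜 E F)
    (hD : ∀ x : ∀ j, E j, D x = (∏ i, T i fun j => x j.1) • y) :
    (∏ i, ‖T i‖) * ‖y‖ ≤ ‖D‖ := by
  by_cases hT : ∀ i, T i ≠ 0
  swap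
  · push Not at hT
    obtain ⟨i, hi⟩ := hT
    rw [Finset.prod_eq_zero (Finset.mem_univ i) (by rw [hi, norm_zero]), zero_mul]
    exact norm_nonneg D
  have hscaled : ∀ c ∈ Set.Ico (0 : ℝ) 1, (∏ i, c * ‖T i‖) * ‖y‖ ≤ ‖D‖ := by
    rintro c ⟨hc0, hc1⟩
    choose x hx0 hx using fun i => exists_mul_opNorm_mul_prod_lt 𝕜 (T i) (hT i) hc0 hc1
    let z : ∀ j, E j := fun j => x (f j) ⟨j, rfl⟩
    have hz : ∀ i, (fun j : {j : ι // f j = i} => z j.1) = x i := by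
      intro i
      funext ⟨j, hj⟩
      subst hj
      rfl
    have hprod : ∏ j, ‖z j‖ = ∏ i, ∏ j, ‖x i j‖ := by
      rw [← Fintype.prod_fiberwise f]
      refine Finset.prod_congr rfl fun i _ => Finset.prod_congr rfl fun j _ => ?_
      rw [← hz i]
    have hpos : 0 < ∏ j, ‖z j‖ := Finset.prod_pos fun j _ => norm_pos_iff.2 (hx0 _ _)
    refine le_of_mul_le_mul_right ?_ hpos
    calc (∏ i, c * ‖T i‖) * ‖y‖ * ∏ j, ‖z j‖
        = (∏ i, c * ‖T i‖ * ∏ j, ‖x i j‖) * ‖y‖ := by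
          rw [hprod, Finset.prod_mul_distrib (f := fun i => c * ‖T i‖)]
          ring
      _ ≤ (∏ i, ‖T i (x i)‖) * ‖y‖ := by
          gcongr with i _
          exact (hx i).le
      _ = ‖D z‖ := by
          rw [hD, norm_smul, norm_prod]
          simp only [hz]
      _ ≤ ‖D‖ * ∏ j, ‖z j‖ := D.le_opNorm z
  have hlim : Tendsto (fun c : ℝ => (∏ i, c * ‖T i‖) * ‖y‖) (𝓝[<] 1)
      (𝓝 ((∏ i, 1 * ‖T i‖) * ‖y‖)) :=
    (Continuous.tendsto (by fun_prop) 1).mono_left nhdsWithin_le_nhds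
  simp only [one_mul] at hlim
  exact le_of_tendsto hlim (Filter.mem_of_superset (Ico_mem_nhdsLT zero_lt_one) hscaled)

/-- If `(H, Nm)` is a quasi-normed hyper-ideal, `T₁,…,Tₙ` are continuous multilinear
forms on consecutive blocks of variables (the fibers of the monotone surjection `f`),
`y ∈ F`, and `D = T₁ ⊗ ⋯ ⊗ Tₙ ⊗ y`, then `D ∈ H` and
`‖D‖_H = ‖D‖ = ‖T₁‖⋯‖Tₙ‖·‖y‖`. -/
theorem tensor_of_forms_mem_and_norm (H : MultiClass 𝕜) (Nm : MultiNorm 𝕜)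
    (hH : ∃ p : ℝ, IsPNormedHyperIdeal 𝕜 H Nm p)
    {n M : ℕ} {E : Fin M → Type} [∀ j, NormedAddCommGroup (E j)]
    [∀ j, NormedSpace 𝕜 (E j)] [∀ j, CompleteSpace (E j)]
    {F : Type} [NormedAddCommGroup F] [NormedSpace 𝕜 F] [CompleteSpace F]
    (f : Fin M → Fin n) (hmono : Monotone f) (hsurj : Function.Surjective f)
    (T : ∀ i : Fin n, ContinuousMultilinearMap 𝕜 (fun j : {j : Fin M // f j = i} => E j.1) 𝕜)
    (y : F) (D : ContinuousMultilinearMap 𝕜 E F)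
    (hD : ∀ x : ∀ j, E j, D x = (∏ i, T i fun j => x j.1) • y) :
    D ∈ H M E F ∧ Nm M E F D = ‖D‖ ∧ ‖D‖ = (∏ i, ‖T i‖) * ‖y‖ := by
  obtain ⟨p, hp⟩ := hH
  have hI := IsHyperIdeal.mkPiAlgebra_mem 𝕜 hp.toIsHyperIdeal n
  let t : 𝕜 →L[𝕜] F := (ContinuousLinearMap.id 𝕜 𝕜).smulRight y
  have ht : ‖t‖ ≤ ‖y‖ := t.opNorm_le_bound (norm_nonneg y) fun c => by
    simp [t, norm_smul, mul_comm]
  have hcomp : IsBlockComp 𝕜 f T (ContinuousMultilinearMap.mkPiAlgebra 𝕜 (Fin n) 𝕜) t D :=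
    fun x => by simp [t, hD]
  have hmem : D ∈ H M E F :=
    hp.comp_mem n M E (fun _ => 𝕜) 𝕜 F f hmono hsurj T _ hI t D hcomp
  have hupper : Nm M E F D ≤ (∏ i, ‖T i‖) * ‖y‖ := by
    have key := hp.norm_comp_le n M E (fun _ => 𝕜) 𝕜 F f hmono hsurj T _ hI t D hcomp
    rw [hp.norm_In, mul_one, mul_comm] at key
    exact key.trans (by gcongr)
  have hlower := prod_opNorm_mul_norm_le 𝕜 f T y D hD
  have hop := hp.opNorm_le 𝕜 hmem
  exact ⟨hmem, le_antisymm (hupper.trans hlower) hop, le_antisymm (hop.trans hupper) hlower⟩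

end
end

section
/- (Series criterion) Let 0 < p ≤ 1 and let H be a subclass of the class of all continuous multilinear operators between Banach spaces endowed with a map ‖·‖_H : H → [0,∞). Then (H,‖·‖_H) is a p-Banach hyper-ideal if and only if: (i) I_n ∈ H(𝕂^n;𝕂) and ‖I_n‖_H = 1 for every n ∈ ℕ; (ii) whenever (A_j)_{j=1}^∞ ⊆ H(E1,…,En;F) satisfies Σ_j ‖A_j‖_H^p < ∞, the operator A := Σ_j A_j (pointwise sum) belongs to H(E1,…,En;F) and ‖A‖_H^p ≤ Σ_j ‖A_j‖_H^p; (iii) for all n ∈ ℕ, naturals 1 ≤ m1 < ⋯ < mn, continuous multilinear operators B1 ∈ L(G1,…,G_{m1};E1), …, Bn ∈ L(G_{m_{n-1}+1},…,G_{mn};En), A ∈ H(E1,…,En;F) and continuous linear t ∈ L(F;H0), one has t∘A∘(B1,…,Bn) ∈ H(G1,…,G_{mn};H0) and ‖t∘A∘(B1,…,Bn)‖_H ≤ ‖t‖·‖A‖_H·‖B1‖⋯‖Bn‖. -/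
open Filter Topology
open scoped ENNReal NNReal BigOperators

noncomputable section

variable (𝕜 : Type) [RCLike 𝕜]

section Helpers

variable {𝕜}

/-- A continuous linear operator on the `i`-th space, seen as a multilinear operator on the
one-element block of variables `{i}`. -/
def ContinuousLinearMap.onSingletonBlock {n : ℕ} {G : Fin n → Type}
    [∀ i, NormedAddCommGroup (G i)] [∀ i, NormedSpace 𝕜 (G i)] {E : Type}
    [NormedAddCommGroup E] [NormedSpace 𝕜 E] {i : Fin n} (u : G i →L[𝕜] E) :
    ContinuousMultilinearMap 𝕜 (fun j : {j : Fin n // id j = i} => G j.1) E where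
  toFun x := u (x ⟨i, rfl⟩)
  map_update_add' := by
    rintro _ m ⟨j, rfl⟩ x y
    simp
  map_update_smul' := by
    rintro _ m ⟨j, rfl⟩ c x
    simp
  cont := u.continuous.comp (continuous_apply _)

lemma ContinuousLinearMap.norm_onSingletonBlock_le {n : ℕ} {G : Fin n → Type}
    [∀ i, NormedAddCommGroup (G i)] [∀ i, NormedSpace 𝕜 (G i)] {E : Type}
    [NormedAddCommGroup E] [NormedSpace 𝕜 E] {i : Fin n} (u : G i →L[𝕜] E) :
    ‖u.onSingletonBlock‖ ≤ ‖u‖ := by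
  refine ContinuousMultilinearMap.opNorm_le_bound (norm_nonneg u) fun x => ?_
  have hprod : ∏ j, ‖x j‖ = ‖x ⟨i, rfl⟩‖ := by
    refine Fintype.prod_eq_single _ fun j hj => absurd ?_ hj
    exact Subtype.ext j.2
  rw [hprod]
  exact u.le_opNorm _

/-- The hyper-ideal property together with the hyper-ideal inequality. -/
def HasHyperIdealInequality (H : MultiClass 𝕜) (Nm : MultiNorm 𝕜) : Prop :=
  ∀ (n M : ℕ) (G : Fin M → Type) [∀ j, NormedAddCommGroup (G j)]
      [∀ j, NormedSpace 𝕜 (G j)] [∀ j, CompleteSpace (G j)]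
      (E : Fin n → Type) [∀ i, NormedAddCommGroup (E i)] [∀ i, NormedSpace 𝕜 (E i)]
      [∀ i, CompleteSpace (E i)]
      (F H0 : Type) [NormedAddCommGroup F] [NormedSpace 𝕜 F] [CompleteSpace F]
      [NormedAddCommGroup H0] [NormedSpace 𝕜 H0] [CompleteSpace H0]
      (f : Fin M → Fin n), Monotone f → Function.Surjective f →
    ∀ (B : ∀ i : Fin n, ContinuousMultilinearMap 𝕜 (fun j : {j : Fin M // f j = i} => G j.1) (E i))
      (A : ContinuousMultilinearMap 𝕜 E F), A ∈ H n E F →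
    ∀ (t : F →L[𝕜] H0) (C : ContinuousMultilinearMap 𝕜 G H0), IsBlockComp 𝕜 f B A t C →
      C ∈ H M G H0 ∧ Nm M G H0 C ≤ ‖t‖ * Nm n E F A * ∏ i, ‖B i‖

/-- The forms `I_n` belong to the class and have norm one. -/
def ContainsUnitForms (H : MultiClass 𝕜) (Nm : MultiNorm 𝕜) : Prop :=
  ∀ n : ℕ, ContinuousMultilinearMap.mkPiAlgebra 𝕜 (Fin n) 𝕜 ∈ H n (fun _ => 𝕜) 𝕜 ∧
    Nm n (fun _ => 𝕜) 𝕜 (ContinuousMultilinearMap.mkPiAlgebra 𝕜 (Fin n) 𝕜) = 1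

/-- Absolutely `p`-summable series converge in the class, with control of the norm. -/
def HasSeriesProperty (H : MultiClass 𝕜) (Nm : MultiNorm 𝕜) (p : ℝ) : Prop :=
  ∀ (n : ℕ) (E : Fin n → Type) [∀ i, NormedAddCommGroup (E i)]
      [∀ i, NormedSpace 𝕜 (E i)] [∀ i, CompleteSpace (E i)]
      (F : Type) [NormedAddCommGroup F] [NormedSpace 𝕜 F] [CompleteSpace F]
      (A : ℕ → ContinuousMultilinearMap 𝕜 E F), (∀ j, A j ∈ H n E F) →
    Summable (fun j => Nm n E F (A j) ^ p) →
    ∃ S : ContinuousMultilinearMap 𝕜 E F, (∀ x, HasSum (fun j => A j x) (S x)) ∧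
      S ∈ H n E F ∧ Nm n E F S ^ p ≤ ∑' j, Nm n E F (A j) ^ p

/-- The norm function takes nonnegative values. -/
def MultiNorm.IsNonneg (Nm : MultiNorm 𝕜) : Prop :=
  ∀ (n : ℕ) (E : Fin n → Type) [∀ i, NormedAddCommGroup (E i)]
      [∀ i, NormedSpace 𝕜 (E i)] [∀ i, CompleteSpace (E i)]
      (F : Type) [NormedAddCommGroup F] [NormedSpace 𝕜 F] [CompleteSpace F]
      (A : ContinuousMultilinearMap 𝕜 E F), 0 ≤ Nm n E F A

variable {H : MultiClass 𝕜} {Nm : MultiNorm 𝕜} {p : ℝ} {n : ℕ} {E : Fin n → Type}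
  [∀ i, NormedAddCommGroup (E i)] [∀ i, NormedSpace 𝕜 (E i)] [∀ i, CompleteSpace (E i)]
  {F : Type} [NormedAddCommGroup F] [NormedSpace 𝕜 F] [CompleteSpace F]

namespace HasHyperIdealInequality

lemma comp_linear (h : HasHyperIdealInequality H Nm) (hN : Nm.IsNonneg)
    {G : Fin n → Type} [∀ i, NormedAddCommGroup (G i)] [∀ i, NormedSpace 𝕜 (G i)]
    [∀ i, CompleteSpace (G i)] {H0 : Type} [NormedAddCommGroup H0] [NormedSpace 𝕜 H0]
    [CompleteSpace H0] {A : ContinuousMultilinearMap 𝕜 E F} (hA : A ∈ H n E F)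
    (t : F →L[𝕜] H0) (u : ∀ i, G i →L[𝕜] E i) {C : ContinuousMultilinearMap 𝕜 G H0}
    (hC : ∀ x, C x = t (A fun i => u i (x i))) :
    C ∈ H n G H0 ∧ Nm n G H0 C ≤ ‖t‖ * Nm n E F A * ∏ i, ‖u i‖ := by
  obtain ⟨hmem, hle⟩ := h n n G E F H0 id monotone_id Function.surjective_id
    (fun i => (u i).onSingletonBlock) A hA t C hC
  refine ⟨hmem, hle.trans ?_⟩
  refine mul_le_mul_of_nonneg_left ?_ (mul_nonneg (norm_nonneg t) (hN n E F A))
  exact Finset.prod_le_prod (fun i _ => norm_nonneg _) fun i _ => (u i).norm_onSingletonBlock_le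

lemma smul_mem_and_le (h : HasHyperIdealInequality H Nm) (hN : Nm.IsNonneg)
    {A : ContinuousMultilinearMap 𝕜 E F} (hA : A ∈ H n E F) (c : 𝕜) :
    c • A ∈ H n E F ∧ Nm n E F (c • A) ≤ ‖c‖ * Nm n E F A := by
  obtain ⟨hmem, hle⟩ := h.comp_linear hN hA (c • ContinuousLinearMap.id 𝕜 F)
    (fun i => ContinuousLinearMap.id 𝕜 (E i)) (C := c • A) fun x => by simp
  refine ⟨hmem, hle.trans ?_⟩
  have hid : ‖c • ContinuousLinearMap.id 𝕜 F‖ ≤ ‖c‖ := by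
    refine ContinuousLinearMap.opNorm_le_bound _ (norm_nonneg c) fun x => ?_
    simp [norm_smul]
  have hprod : ∏ i, ‖ContinuousLinearMap.id 𝕜 (E i)‖ ≤ 1 :=
    Finset.prod_le_one (fun i _ => norm_nonneg _) fun i _ => ContinuousLinearMap.norm_id_le
  have hNA := hN n E F A
  calc ‖c • ContinuousLinearMap.id 𝕜 F‖ * Nm n E F A * ∏ i, ‖ContinuousLinearMap.id 𝕜 (E i)‖
      ≤ ‖c • ContinuousLinearMap.id 𝕜 F‖ * Nm n E F A :=
        mul_le_of_le_one_right (by positivity) hprod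
    _ ≤ ‖c‖ * Nm n E F A := by gcongr

lemma norm_smul_eq (h : HasHyperIdealInequality H Nm) (hN : Nm.IsNonneg)
    {A : ContinuousMultilinearMap 𝕜 E F} (hA : A ∈ H n E F) (c : 𝕜) :
    Nm n E F (c • A) = ‖c‖ * Nm n E F A := by
  obtain ⟨hmem, hle⟩ := h.smul_mem_and_le hN hA c
  refine le_antisymm hle ?_
  rcases eq_or_ne c 0 with rfl | hc
  · simpa using hN n E F _
  · have hback := (h.smul_mem_and_le hN hmem c⁻¹).2
    rw [smul_smul, inv_mul_cancel₀ hc, one_smul, norm_inv] at hback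
    exact (le_inv_mul_iff₀ (norm_pos_iff.2 hc)).1 hback

lemma neg_mem (h : HasHyperIdealInequality H Nm) (hN : Nm.IsNonneg)
    {A : ContinuousMultilinearMap 𝕜 E F} (hA : A ∈ H n E F) : -A ∈ H n E F := by
  simpa using (h.smul_mem_and_le hN hA (-1)).1

lemma norm_neg_eq (h : HasHyperIdealInequality H Nm) (hN : Nm.IsNonneg)
    {A : ContinuousMultilinearMap 𝕜 E F} (hA : A ∈ H n E F) :
    Nm n E F (-A) = Nm n E F A := by
  simpa using h.norm_smul_eq hN hA (-1)

lemma opNorm_le (h : HasHyperIdealInequality H Nm) (hN : Nm.IsNonneg)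
    (hI : ContainsUnitForms H Nm) {A : ContinuousMultilinearMap 𝕜 E F} (hA : A ∈ H n E F) :
    ‖A‖ ≤ Nm n E F A := by
  refine ContinuousMultilinearMap.opNorm_le_bound (hN n E F A) fun x => ?_
  have hNA := hN n E F A
  refine NormedSpace.norm_le_dual_bound 𝕜 (A x) (by positivity) fun φ => ?_
  have hle := (h.comp_linear hN hA φ (fun i => ContinuousLinearMap.toSpanSingleton 𝕜 (x i))
    (C := φ (A x) • ContinuousMultilinearMap.mkPiAlgebra 𝕜 (Fin n) 𝕜) fun y => by
      simp [ContinuousMultilinearMap.map_smul_univ, mul_comm]).2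
  rw [h.norm_smul_eq hN (hI n).1, (hI n).2] at hle
  simp only [ContinuousLinearMap.norm_toSpanSingleton, mul_one] at hle
  linarith

lemma elementary_mem (h : HasHyperIdealInequality H Nm) (hN : Nm.IsNonneg)
    (hI : ContainsUnitForms H Nm) {A : ContinuousMultilinearMap 𝕜 E F}
    (φ : ∀ i, E i →L[𝕜] 𝕜) (y : F) (hA : ∀ x, A x = (∏ i, φ i (x i)) • y) :
    A ∈ H n E F :=
  (h.comp_linear hN (hI n).1 (ContinuousLinearMap.toSpanSingleton 𝕜 y) φ fun x => by
    simp [hA]).1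

lemma zero_mem_and_norm (h : HasHyperIdealInequality H Nm) (hN : Nm.IsNonneg)
    (hI : ContainsUnitForms H Nm) :
    (0 : ContinuousMultilinearMap 𝕜 E F) ∈ H n E F ∧
      Nm n E F (0 : ContinuousMultilinearMap 𝕜 E F) = 0 := by
  have hmem : (0 : ContinuousMultilinearMap 𝕜 E F) ∈ H n E F :=
    h.elementary_mem hN hI 0 0 (by simp)
  exact ⟨hmem, by simpa using h.norm_smul_eq hN hmem 0⟩

lemma add_mem_and_le (h : HasHyperIdealInequality H Nm) (hN : Nm.IsNonneg)
    (hI : ContainsUnitForms H Nm) (hS : HasSeriesProperty H Nm p) (hp : 0 < p)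
    {A B : ContinuousMultilinearMap 𝕜 E F} (hA : A ∈ H n E F) (hB : B ∈ H n E F) :
    A + B ∈ H n E F ∧ Nm n E F (A + B) ^ p ≤ Nm n E F A ^ p + Nm n E F B ^ p := by
  obtain ⟨h0, hN0⟩ := h.zero_mem_and_norm hN hI (E := E) (F := F)
  let u : ℕ → ContinuousMultilinearMap 𝕜 E F := fun j =>
    if j = 0 then A else if j = 1 then B else 0
  have hu : ∀ j, j ∉ Finset.range 2 → u j = 0 := fun j hj => by
    have : 2 ≤ j := not_lt.1 (mt Finset.mem_range.2 hj)
    simp only [u, if_neg (show j ≠ 0 by omega), if_neg (show j ≠ 1 by omega)]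
  have hNu : HasSum (fun j => Nm n E F (u j) ^ p) (∑ j ∈ Finset.range 2, Nm n E F (u j) ^ p) :=
    hasSum_sum_of_ne_finset_zero fun j hj => by
      simp only [hu j hj, hN0, Real.zero_rpow hp.ne']
  obtain ⟨S, hsum, hmem, hle⟩ := hS n E F u
    (fun j => by simp only [u]; split_ifs <;> assumption) hNu.summable
  have hSeq : S = A + B := by
    ext x
    have hx : HasSum (fun j => u j x) (∑ j ∈ Finset.range 2, u j x) :=
      hasSum_sum_of_ne_finset_zero fun j hj => by simp [hu j hj]
    rw [(hsum x).unique hx]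
    simp [Finset.sum_range_succ, u]
  rw [hNu.tsum_eq] at hle
  subst hSeq
  exact ⟨hmem, by simpa [Finset.sum_range_succ, u] using hle⟩

lemma finiteType_mem (h : HasHyperIdealInequality H Nm) (hN : Nm.IsNonneg)
    (hI : ContainsUnitForms H Nm) (hS : HasSeriesProperty H Nm p) (hp : 0 < p)
    {A : ContinuousMultilinearMap 𝕜 E F} (hA : IsFiniteType 𝕜 A) : A ∈ H n E F := by
  induction hA using Submodule.span_induction with
  | mem B hB =>
    obtain ⟨φ, y, hφ⟩ := hB
    exact h.elementary_mem hN hI φ y hφ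
  | zero => exact (h.zero_mem_and_norm hN hI).1
  | add B C _ _ hB hC => exact (h.add_mem_and_le hN hI hS hp hB hC).1
  | smul c B _ hB => exact (h.smul_mem_and_le hN hB c).1

lemma complete (h : HasHyperIdealInequality H Nm) (hN : Nm.IsNonneg)
    (hI : ContainsUnitForms H Nm) (hS : HasSeriesProperty H Nm p) (hp : 0 < p)
    (u : ℕ → ContinuousMultilinearMap 𝕜 E F) (hu : ∀ k, u k ∈ H n E F)
    (hcauchy : ∀ ε : ℝ, 0 < ε → ∃ K : ℕ, ∀ k ≥ K, ∀ l ≥ K, Nm n E F (u k - u l) < ε) :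
    ∃ A ∈ H n E F, Tendsto (fun k => Nm n E F (u k - A)) atTop (𝓝 0) := by
  have hsub : ∀ {A B : ContinuousMultilinearMap 𝕜 E F}, A ∈ H n E F → B ∈ H n E F →
      A - B ∈ H n E F := fun hA hB => by
    rw [sub_eq_add_neg]
    exact (h.add_mem_and_le hN hI hS hp hA (h.neg_mem hN hB)).1
  have hK : ∀ j : ℕ, ∃ K : ℕ, ∀ k ≥ K, ∀ l ≥ K,
      Nm n E F (u k - u l) ^ p ≤ (1 / 2 : ℝ) ^ j := fun j => by
    obtain ⟨K, hK⟩ := hcauchy (((1 / 2 : ℝ) ^ j) ^ p⁻¹) (by positivity)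
    refine ⟨K, fun k hk l hl => ?_⟩
    exact (Real.le_rpow_inv_iff_of_pos (hN n E F _) (by positivity) hp).1 (hK k hk l hl).le
  choose K hK using hK
  let φ : ℕ → ℕ := fun j => ∑ i ∈ Finset.range (j + 1), K i
  have hKφ : ∀ j, K j ≤ φ j := fun j =>
    Finset.single_le_sum (f := K) (fun i _ => Nat.zero_le _) (Finset.self_mem_range_succ j)
  have hφ : ∀ j, φ j ≤ φ (j + 1) := fun j => by
    simp only [φ, Finset.sum_range_succ _ (j + 1)]
    exact Nat.le_add_right _ _
  let a : ℕ → ContinuousMultilinearMap 𝕜 E F := fun j => u (φ (j + 1)) - u (φ j)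
  have ha : ∀ j, a j ∈ H n E F := fun j => hsub (hu _) (hu _)
  have hNa : ∀ j, Nm n E F (a j) ^ p ≤ (1 / 2 : ℝ) ^ j := fun j =>
    hK j _ ((hKφ j).trans (hφ j)) _ (hKφ j)
  have hNa0 : ∀ j, 0 ≤ Nm n E F (a j) ^ p := fun j => Real.rpow_nonneg (hN n E F _) p
  have hgeom : ∀ J : ℕ, HasSum (fun j => (1 / 2 : ℝ) ^ (j + J)) (2 * (1 / 2 : ℝ) ^ J) := fun J => by
    simpa only [pow_add] using hasSum_geometric_two.mul_right ((1 / 2 : ℝ) ^ J)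
  have htail : ∀ J : ℕ, ∃ S : ContinuousMultilinearMap 𝕜 E F,
      (∀ x, Tendsto (fun m => u (φ m) x) atTop (𝓝 (S x + u (φ J) x))) ∧
        S ∈ H n E F ∧ Nm n E F S ^ p ≤ 2 * (1 / 2 : ℝ) ^ J := fun J => by
    have hsummable : Summable fun j => Nm n E F (a (j + J)) ^ p :=
      (hgeom J).summable.of_nonneg_of_le (fun j => hNa0 _) fun j => hNa _
    obtain ⟨S, hsum, hmem, hle⟩ := hS n E F (fun j => a (j + J)) (fun j => ha _) hsummable
    refine ⟨S, fun x => ?_, hmem, hle.trans ?_⟩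
    · rw [← tendsto_add_atTop_iff_nat J]
      refine ((hsum x).tendsto_sum_nat.add_const (u (φ J) x)).congr fun m => ?_
      have htel := Finset.sum_range_sub (fun j => u (φ (j + J)) x) m
      simp only [zero_add] at htel
      rw [← eq_sub_iff_add_eq, ← htel]
      simp [a, add_right_comm]
    · rw [← (hgeom J).tsum_eq]
      exact hsummable.tsum_le_tsum (fun j => hNa _) (hgeom J).summable
  choose S hlim hSmem hSle using htail
  have hA : ∀ J, S 0 + u (φ 0) = S J + u (φ J) := fun J => by
    ext x
    exact tendsto_nhds_unique (hlim 0 x) (hlim J x)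
  refine ⟨S 0 + u (φ 0), (h.add_mem_and_le hN hI hS hp (hSmem 0) (hu _)).1, ?_⟩
  have hbound : ∀ J, ∀ k ≥ φ J,
      Nm n E F (u k - (S 0 + u (φ 0))) ^ p ≤ 3 * (1 / 2 : ℝ) ^ J := fun J k hk => by
    have hdecomp : u k - (S 0 + u (φ 0)) = (u k - u (φ J)) + -S J := by
      rw [hA J]; abel
    have hadd := (h.add_mem_and_le hN hI hS hp (hsub (hu k) (hu (φ J)))
      (h.neg_mem hN (hSmem J))).2
    rw [← hdecomp, h.norm_neg_eq hN (hSmem J)] at hadd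
    linarith [hK J k ((hKφ J).trans hk) _ (hKφ J), hSle J]
  have hlimp : Tendsto (fun k => Nm n E F (u k - (S 0 + u (φ 0))) ^ p) atTop (𝓝 0) := by
    have h3 : Tendsto (fun J : ℕ => 3 * (1 / 2 : ℝ) ^ J) atTop (𝓝 0) := by
      simpa using (tendsto_pow_atTop_nhds_zero_of_lt_one (r := (1 / 2 : ℝ))
        (by norm_num) (by norm_num)).const_mul 3
    rw [Metric.tendsto_atTop]
    intro ε hε
    obtain ⟨J, hJ⟩ := (h3.eventually_lt_const hε).exists
    refine ⟨φ J, fun k hk => ?_⟩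
    rw [Real.dist_0_eq_abs, abs_of_nonneg (Real.rpow_nonneg (hN n E F _) p)]
    exact (hbound J k hk).trans_lt hJ
  have := hlimp.rpow_const (p := p⁻¹) (Or.inr (by positivity))
  rw [Real.zero_rpow (inv_ne_zero hp.ne')] at this
  exact this.congr fun k => Real.rpow_rpow_inv (hN n E F _) hp.ne'

end HasHyperIdealInequality

namespace IsPBanachHyperIdeal

lemma hasHyperIdealInequality (h : IsPBanachHyperIdeal 𝕜 H Nm p) :
    HasHyperIdealInequality H Nm := by
  intro n M G _ _ _ E _ _ _ F H0 _ _ _ _ _ _ f hf hf' B A hA t C hC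
  exact ⟨h.comp_mem n M G E F H0 f hf hf' B A hA t C hC,
    h.norm_comp_le n M G E F H0 f hf hf' B A hA t C hC⟩

lemma containsUnitForms (h : IsPBanachHyperIdeal 𝕜 H Nm p) : ContainsUnitForms H Nm := by
  refine fun n => ⟨h.finiteType_mem n _ _ _ (Submodule.subset_span ?_), h.norm_In n⟩
  exact ⟨fun _ => ContinuousLinearMap.id 𝕜 𝕜, 1, fun x => by simp⟩

lemma sum_mem_and_le (h : IsPBanachHyperIdeal 𝕜 H Nm p)
    {A : ℕ → ContinuousMultilinearMap 𝕜 E F} (hA : ∀ j, A j ∈ H n E F) (s : Finset ℕ) :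
    ∑ j ∈ s, A j ∈ H n E F ∧ Nm n E F (∑ j ∈ s, A j) ^ p ≤ ∑ j ∈ s, Nm n E F (A j) ^ p := by
  induction s using Finset.induction_on with
  | empty =>
    have h0 := h.zero_mem n E F
    simp [h0, (h.norm_eq_zero_iff n E F h0).2 rfl, Real.zero_rpow h.p_pos.ne']
  | insert i s hi ih =>
    rw [Finset.sum_insert hi, Finset.sum_insert hi]
    exact ⟨h.add_mem n E F (hA i) ih.1, (h.norm_add_le n E F (hA i) ih.1).trans (by linarith [ih.2])⟩

lemma hasSeriesProperty (h : IsPBanachHyperIdeal 𝕜 H Nm p) : HasSeriesProperty H Nm p := by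
  intro n E _ _ _ F _ _ _ A hA hsummable
  have hp := h.p_pos
  have hN : Nm.IsNonneg := fun n E _ _ _ F _ _ _ => h.norm_nonneg' n E F
  have hineq := h.hasHyperIdealInequality
  have hop : ∀ {B : ContinuousMultilinearMap 𝕜 E F}, B ∈ H n E F → ‖B‖ ≤ Nm n E F B :=
    fun hB => hineq.opNorm_le hN h.containsUnitForms hB
  have hNA0 : ∀ j, 0 ≤ Nm n E F (A j) ^ p := fun j => Real.rpow_nonneg (hN n E F _) p
  let s : ℕ → ContinuousMultilinearMap 𝕜 E F := fun k => ∑ j ∈ Finset.range k, A j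
  have hs : ∀ k, s k ∈ H n E F := fun k => (h.sum_mem_and_le hA _).1
  have hdiff : ∀ k l, k ≤ l →
      Nm n E F (s l - s k) ^ p ≤ ∑ j ∈ Finset.Ico k l, Nm n E F (A j) ^ p := fun k l hkl => by
    rw [← Finset.sum_Ico_eq_sub _ hkl]
    exact (h.sum_mem_and_le hA _).2
  have hcauchy : ∀ ε : ℝ, 0 < ε → ∃ K : ℕ, ∀ k ≥ K, ∀ l ≥ K, Nm n E F (s k - s l) < ε := by
    intro ε hε
    obtain ⟨K, hK⟩ := ((tendsto_sum_nat_add fun j => Nm n E F (A j) ^ p).eventually_lt_const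
      (Real.rpow_pos_of_pos hε p)).exists
    have hlt : ∀ k ≥ K, ∀ l ≥ k, Nm n E F (s l - s k) < ε := fun k hk l hl => by
      rw [← Real.rpow_lt_rpow_iff (hN n E F _) hε.le hp]
      refine ((hdiff k l hl).trans ?_).trans_lt hK
      have hsub : Finset.Ico k l ⊆ Finset.Ico K l := Finset.Ico_subset_Ico_left hk
      refine (Finset.sum_le_sum_of_subset_of_nonneg hsub fun j _ _ => hNA0 j).trans ?_
      simp only [Finset.sum_Ico_eq_sum_range, add_comm K]
      exact ((summable_nat_add_iff K).2 hsummable).sum_le_tsum _ fun j _ => hNA0 _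
    refine ⟨K, fun k hk l hl => ?_⟩
    rcases le_total k l with hkl | hlk
    · rw [← neg_sub, hineq.norm_neg_eq hN]
      · exact hlt k hk l hkl
      · rw [← Finset.sum_Ico_eq_sub _ hkl]
        exact (h.sum_mem_and_le hA _).1
    · exact hlt l hl k hlk
  obtain ⟨S, hSmem, hS⟩ := h.complete n E F s hs hcauchy
  have hdmem : ∀ k, s k - S ∈ H n E F := fun k => by
    rw [sub_eq_add_neg]
    exact h.add_mem n E F (hs k) (hineq.neg_mem hN hSmem)
  have hnorm : Summable fun j => ‖A j‖ := by
    have hev : ∀ᶠ j in cofinite, Nm n E F (A j) ^ p ≤ 1 :=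
      hsummable.tendsto_cofinite_zero.eventually_le_const one_pos
    refine Summable.of_norm_bounded_eventually hsummable (hev.mono fun j hj => ?_)
    have hle : Nm n E F (A j) ≤ 1 := by
      rw [← Real.one_rpow p] at hj
      exact (Real.rpow_le_rpow_iff (hN n E F _) zero_le_one hp).1 hj
    rw [norm_norm]
    exact (hop (hA j)).trans (Real.self_le_rpow_of_le_one (hN n E F _) hle h.p_le_one)
  have hsS : Tendsto s atTop (𝓝 S) := by
    rw [tendsto_iff_norm_sub_tendsto_zero]
    exact squeeze_zero (fun k => norm_nonneg _) (fun k => hop (hdmem k)) hS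
  have hsum : HasSum A S := (hasSum_iff_tendsto_nat_of_summable_norm hnorm).2 hsS
  refine ⟨S, fun x => ContinuousMultilinearMap.hasSum_eval hsum x, hSmem, ?_⟩
  have hlim : Tendsto (fun k => Nm n E F (s k - S) ^ p + ∑' j, Nm n E F (A j) ^ p) atTop
      (𝓝 (∑' j, Nm n E F (A j) ^ p)) := by
    simpa [Real.zero_rpow hp.ne'] using
      (hS.rpow_const (p := p) (Or.inr hp.le)).add_const (∑' j, Nm n E F (A j) ^ p)
  refine ge_of_tendsto' hlim fun k => ?_
  have hadd := h.norm_add_le n E F (hineq.neg_mem hN (hdmem k)) (hs k)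
  rw [hineq.norm_neg_eq hN (hdmem k), neg_sub, sub_add_cancel] at hadd
  refine hadd.trans (add_le_add_right ?_ _)
  exact (h.sum_mem_and_le hA _).2.trans (hsummable.sum_le_tsum _ fun j _ => hNA0 j)

end IsPBanachHyperIdeal

end Helpers

/-- Series criterion for `p`-Banach hyper-ideals. -/
theorem series_criterion (H : MultiClass 𝕜) (Nm : MultiNorm 𝕜) (p : ℝ)
    (hp : 0 < p) (hp1 : p ≤ 1)
    (hnonneg : ∀ (n : ℕ) (E : Fin n → Type) [∀ i, NormedAddCommGroup (E i)]
      [∀ i, NormedSpace 𝕜 (E i)] [∀ i, CompleteSpace (E i)]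
      (F : Type) [NormedAddCommGroup F] [NormedSpace 𝕜 F] [CompleteSpace F]
      (A : ContinuousMultilinearMap 𝕜 E F), 0 ≤ Nm n E F A) :
    IsPBanachHyperIdeal 𝕜 H Nm p ↔
      ((∀ n : ℕ, ContinuousMultilinearMap.mkPiAlgebra 𝕜 (Fin n) 𝕜 ∈ H n (fun _ => 𝕜) 𝕜 ∧
          Nm n (fun _ => 𝕜) 𝕜 (ContinuousMultilinearMap.mkPiAlgebra 𝕜 (Fin n) 𝕜) = 1) ∧
       (∀ (n : ℕ) (E : Fin n → Type) [∀ i, NormedAddCommGroup (E i)]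
      [∀ i, NormedSpace 𝕜 (E i)] [∀ i, CompleteSpace (E i)]
      (F : Type) [NormedAddCommGroup F] [NormedSpace 𝕜 F] [CompleteSpace F]
          (A : ℕ → ContinuousMultilinearMap 𝕜 E F), (∀ j, A j ∈ H n E F) →
          Summable (fun j => Nm n E F (A j) ^ p) →
          ∃ S : ContinuousMultilinearMap 𝕜 E F, (∀ x, HasSum (fun j => A j x) (S x)) ∧
            S ∈ H n E F ∧ Nm n E F S ^ p ≤ ∑' j, Nm n E F (A j) ^ p) ∧
       (∀ (n M : ℕ) (G : Fin M → Type) [∀ j, NormedAddCommGroup (G j)]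
      [∀ j, NormedSpace 𝕜 (G j)] [∀ j, CompleteSpace (G j)]
      (E : Fin n → Type) [∀ i, NormedAddCommGroup (E i)] [∀ i, NormedSpace 𝕜 (E i)]
      [∀ i, CompleteSpace (E i)]
      (F H0 : Type) [NormedAddCommGroup F] [NormedSpace 𝕜 F] [CompleteSpace F]
      [NormedAddCommGroup H0] [NormedSpace 𝕜 H0] [CompleteSpace H0]
          (f : Fin M → Fin n), Monotone f → Function.Surjective f →
          ∀ (B : ∀ i : Fin n, ContinuousMultilinearMap 𝕜 (fun j : {j : Fin M // f j = i} => G j.1) (E i))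
            (A : ContinuousMultilinearMap 𝕜 E F), A ∈ H n E F →
          ∀ (t : F →L[𝕜] H0) (C : ContinuousMultilinearMap 𝕜 G H0),
            IsBlockComp 𝕜 f B A t C →
            C ∈ H M G H0 ∧ Nm M G H0 C ≤ ‖t‖ * Nm n E F A * ∏ i, ‖B i‖)) := by
  constructor
  · intro h
    exact ⟨h.containsUnitForms, h.hasSeriesProperty, h.hasHyperIdealInequality⟩
  · rintro ⟨hI, hS, hineq⟩
    replace hI : ContainsUnitForms H Nm := hI
    replace hS : HasSeriesProperty H Nm p := hS
    replace hineq : HasHyperIdealInequality H Nm := hineq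
    have hN : Nm.IsNonneg := hnonneg
    exact
      { zero_mem := fun n E _ _ _ F _ _ _ => (hineq.zero_mem_and_norm hN hI).1
        add_mem := fun n E _ _ _ F _ _ _ _ _ hA hB =>
          (hineq.add_mem_and_le hN hI hS hp hA hB).1
        smul_mem := fun n E _ _ _ F _ _ _ c _ hA => (hineq.smul_mem_and_le hN hA c).1
        comp_mem := fun n M G _ _ _ E _ _ _ F H0 _ _ _ _ _ _ f hf hf' B A hA t C hC =>
          (hineq n M G E F H0 f hf hf' B A hA t C hC).1
        finiteType_mem := fun n E _ _ _ F _ _ _ A hA => hineq.finiteType_mem hN hI hS hp hA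
        p_pos := hp
        p_le_one := hp1
        norm_nonneg' := hnonneg
        norm_eq_zero_iff := fun n E _ _ _ F _ _ _ A hA =>
          ⟨fun h0 => norm_le_zero_iff.1 ((hineq.opNorm_le hN hI hA).trans h0.le),
            fun h0 => h0 ▸ (hineq.zero_mem_and_norm hN hI).2⟩
        norm_smul := fun n E _ _ _ F _ _ _ c _ hA => hineq.norm_smul_eq hN hA c
        norm_add_le := fun n E _ _ _ F _ _ _ _ _ hA hB =>
          (hineq.add_mem_and_le hN hI hS hp hA hB).2
        norm_In := fun n => (hI n).2
        norm_comp_le := fun n M G _ _ _ E _ _ _ F H0 _ _ _ _ _ _ f hf hf' B A hA t C hC =>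
          (hineq n M G E F H0 f hf hf' B A hA t C hC).2
        complete := fun n E _ _ _ F _ _ _ u hu hc => hineq.complete hN hI hS hp u hu hc }

end
end

section
/- Let 0 < p ≤ 1 and let (G,‖·‖_G) and (H,‖·‖_H) be p-Banach hyper-ideals such that G ⊆ H (every component of G is contained in the corresponding component of H). Then for every n ∈ ℕ there is a constant C_n, depending only on n, such that ‖A‖_H ≤ C_n ‖A‖_G for all Banach spaces E1,…,En,F and every A ∈ G(E1,…,En;F). -/
open Filter Topology
open scoped ENNReal NNReal BigOperators

noncomputable section

variable (𝕜 : Type) [RCLike 𝕜]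

section LinearComposition

variable {𝕜}

/-- A continuous linear map, seen as a continuous multilinear map on the `i`-th fiber of the
identity of `Fin n`. -/
def ContinuousLinearMap.toFiberMultilinear {n : ℕ} {D : Fin n → Type}
    [∀ i, NormedAddCommGroup (D i)] [∀ i, NormedSpace 𝕜 (D i)] {X : Type}
    [NormedAddCommGroup X] [NormedSpace 𝕜 X] {i : Fin n} (u : D i →L[𝕜] X) :
    ContinuousMultilinearMap 𝕜 (fun j : {j : Fin n // id j = i} => D j.1) X where
  toFun x := u (x ⟨i, rfl⟩)
  map_update_add' := by
    rintro _ x ⟨j, hj⟩ a b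
    obtain rfl : j = i := hj
    simp
  map_update_smul' := by
    rintro _ x ⟨j, hj⟩ c a
    obtain rfl : j = i := hj
    simp
  cont := u.continuous.comp (continuous_apply _)

theorem ContinuousLinearMap.norm_toFiberMultilinear_le {n : ℕ} {D : Fin n → Type}
    [∀ i, NormedAddCommGroup (D i)] [∀ i, NormedSpace 𝕜 (D i)] {X : Type}
    [NormedAddCommGroup X] [NormedSpace 𝕜 X] {i : Fin n} (u : D i →L[𝕜] X) :
    ‖u.toFiberMultilinear‖ ≤ ‖u‖ := by
  refine ContinuousMultilinearMap.opNorm_le_bound (norm_nonneg _) fun x => ?_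
  let _ : Unique {j : Fin n // id j = i} := ⟨⟨⟨i, rfl⟩⟩, fun j => Subtype.ext j.2⟩
  rw [Fintype.prod_unique]
  exact u.le_opNorm _

variable {H : MultiClass 𝕜} {N : MultiNorm 𝕜} {p : ℝ} {n : ℕ}
  {D E : Fin n → Type} [∀ i, NormedAddCommGroup (D i)] [∀ i, NormedSpace 𝕜 (D i)]
  [∀ i, CompleteSpace (D i)] [∀ i, NormedAddCommGroup (E i)] [∀ i, NormedSpace 𝕜 (E i)]
  [∀ i, CompleteSpace (E i)] {F F' : Type} [NormedAddCommGroup F] [NormedSpace 𝕜 F]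
  [CompleteSpace F] [NormedAddCommGroup F'] [NormedSpace 𝕜 F'] [CompleteSpace F']

theorem IsHyperIdealCore.comp_linear_mem (hH : IsHyperIdealCore 𝕜 H) (t : F →L[𝕜] F')
    {A : ContinuousMultilinearMap 𝕜 E F} (hA : A ∈ H n E F) (u : ∀ i, D i →L[𝕜] E i) :
    t.compContinuousMultilinearMap (A.compContinuousLinearMap u) ∈ H n D F' :=
  hH.comp_mem n n D E F F' id monotone_id Function.surjective_id
    (fun i => (u i).toFiberMultilinear) A hA t _ fun _ => rfl

theorem IsPNormedHyperIdeal.norm_comp_linear_le (hH : IsPNormedHyperIdeal 𝕜 H N p)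
    {t : F →L[𝕜] F'} (ht : ‖t‖ ≤ 1) {A : ContinuousMultilinearMap 𝕜 E F} (hA : A ∈ H n E F)
    {u : ∀ i, D i →L[𝕜] E i} (hu : ∀ i, ‖u i‖ ≤ 1) :
    N n D F' (t.compContinuousMultilinearMap (A.compContinuousLinearMap u)) ≤ N n E F A := by
  have hN := hH.norm_nonneg' n E F A
  calc _ ≤ ‖t‖ * N n E F A * ∏ i, ‖(u i).toFiberMultilinear‖ :=
        hH.norm_comp_le n n D E F F' id monotone_id Function.surjective_id
          (fun i => (u i).toFiberMultilinear) A hA t _ fun _ => rfl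
    _ ≤ 1 * N n E F A * 1 := by
        gcongr
        exact Finset.prod_le_one (fun _ _ => norm_nonneg _)
          fun i _ => (u i).norm_toFiberMultilinear_le.trans (hu i)
    _ = N n E F A := by ring

theorem IsHyperIdealCore.sub_mem (hH : IsHyperIdealCore 𝕜 H)
    {A B : ContinuousMultilinearMap 𝕜 E F} (hA : A ∈ H n E F) (hB : B ∈ H n E F) :
    A - B ∈ H n E F := by
  simpa [sub_eq_add_neg] using hH.add_mem n E F hA (hH.smul_mem n E F (-1) hB)

theorem IsHyperIdealCore.sum_mem (hH : IsHyperIdealCore 𝕜 H)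
    {T : ℕ → ContinuousMultilinearMap 𝕜 E F} (hT : ∀ k, T k ∈ H n E F) (m : ℕ) :
    ∑ k ∈ Finset.range m, T k ∈ H n E F := by
  induction m with
  | zero => simpa using hH.zero_mem n E F
  | succ m ih => simpa [Finset.sum_range_succ] using hH.add_mem n E F ih (hT m)

theorem IsPNormedHyperIdeal.norm_sub_comm (hH : IsPNormedHyperIdeal 𝕜 H N p)
    {A B : ContinuousMultilinearMap 𝕜 E F} (hA : A ∈ H n E F) (hB : B ∈ H n E F) :
    N n E F (A - B) = N n E F (B - A) := by
  simpa using hH.norm_smul n E F (-1) (hH.sub_mem hB hA)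

/-- A series whose terms have geometrically decreasing `p`-norms converges in a `p`-Banach
hyper-ideal. -/
theorem IsPBanachHyperIdeal.exists_tendsto_sum (hH : IsPBanachHyperIdeal 𝕜 H N p)
    {T : ℕ → ContinuousMultilinearMap 𝕜 E F} (hT : ∀ k, T k ∈ H n E F)
    (hN : ∀ k, N n E F (T k) ≤ (1 / 2) ^ k) :
    ∃ A ∈ H n E F,
      Tendsto (fun m => N n E F (∑ k ∈ Finset.range m, T k - A)) atTop (𝓝 0) := by
  have hp := hH.p_pos
  have hS := hH.sum_mem hT
  set S : ℕ → ContinuousMultilinearMap 𝕜 E F := fun m => ∑ k ∈ Finset.range m, T k with hSdef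
  set r : ℝ := (1 / 2) ^ p with hr
  have hr0 : 0 ≤ r := by positivity
  have hr1 : r < 1 := Real.rpow_lt_one (by norm_num) (by norm_num) hp
  have hr1' : 0 < 1 - r := by linarith
  have hTr : ∀ k, N n E F (T k) ^ p ≤ r ^ k := fun k => by
    calc N n E F (T k) ^ p ≤ ((1 / 2 : ℝ) ^ k) ^ p :=
          Real.rpow_le_rpow (hH.norm_nonneg' n E F _) (hN k) hp.le
      _ = r ^ k := Real.rpow_pow_comm (by norm_num) p k |>.symm
  have htail : ∀ j k, N n E F (S (k + j) - S k) ^ p ≤ r ^ k / (1 - r) := by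
    intro j
    induction j with
    | zero =>
      intro k
      have h0 : N n E F 0 = 0 := (hH.norm_eq_zero_iff n E F (hH.zero_mem n E F)).2 rfl
      simp only [add_zero, sub_self, h0, Real.zero_rpow hp.ne']
      positivity
    | succ j ih =>
      intro k
      have hsplit : S (k + (j + 1)) - S k = T k + (S (k + 1 + j) - S (k + 1)) := by
        rw [show k + (j + 1) = k + 1 + j by ring]
        simp only [hSdef, Finset.sum_range_succ _ k]
        abel
      rw [hsplit]
      calc _ ≤ N n E F (T k) ^ p + N n E F (S (k + 1 + j) - S (k + 1)) ^ p :=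
            hH.norm_add_le n E F (hT k) (hH.sub_mem (hS _) (hS _))
        _ ≤ r ^ k + r ^ (k + 1) / (1 - r) := add_le_add (hTr k) (ih (k + 1))
        _ = r ^ k / (1 - r) := by field_simp; ring
  refine hH.complete n E F S hS fun ε hε => ?_
  have hlim : Tendsto (fun k => r ^ k / (1 - r)) atTop (𝓝 0) := by
    simpa using (tendsto_pow_atTop_nhds_zero_of_lt_one hr0 hr1).div_const (1 - r)
  obtain ⟨K, hK⟩ := eventually_atTop.1 (hlim.eventually_lt_const (Real.rpow_pos_of_pos hε p))
  have hlt : ∀ k ≥ K, ∀ l ≥ k, N n E F (S l - S k) < ε := by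
    intro k hk l hl
    obtain ⟨j, rfl⟩ := Nat.exists_eq_add_of_le hl
    exact (Real.rpow_lt_rpow_iff (hH.norm_nonneg' n E F _) hε.le hp).1
      ((htail j k).trans_lt (hK k hk))
  refine ⟨K, fun k hk l hl => ?_⟩
  rcases le_total k l with h | h
  · rw [hH.norm_sub_comm (hS k) (hS l)]
    exact hlt k hk l h
  · exact hlt l hl k h

end LinearComposition

section LpSum

variable (X : ℕ → Type) [∀ k, NormedAddCommGroup (X k)] [∀ k, NormedSpace 𝕜 (X k)]

theorem lp.norm_singleContinuousLinearMap_top_le (k : ℕ) :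
    ‖lp.singleContinuousLinearMap 𝕜 X ∞ k‖ ≤ 1 :=
  ContinuousLinearMap.opNorm_le_bound _ zero_le_one fun x => by
    rw [one_mul]
    exact (lp.norm_single ENNReal.zero_lt_top k x).le

theorem lp.norm_evalCLM_top_le (k : ℕ) : ‖lp.evalCLM 𝕜 X ∞ k‖ ≤ 1 :=
  LinearMap.mkContinuous_norm_le _ zero_le_one _

theorem lp.evalCLM_singleContinuousLinearMap_self (k : ℕ) (x : X k) :
    lp.evalCLM 𝕜 X ∞ k (lp.singleContinuousLinearMap 𝕜 X ∞ k x) = x :=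
  lp.single_apply_self ∞ k x

theorem lp.evalCLM_singleContinuousLinearMap_of_ne {j k : ℕ} (h : k ≠ j) (x : X j) :
    lp.evalCLM 𝕜 X ∞ k (lp.singleContinuousLinearMap 𝕜 X ∞ j x) = 0 :=
  lp.single_apply_ne ∞ j x h

end LpSum

/-- Operators in `G` whose `G`-norms decrease geometrically are simultaneously factors, through
norm-one linear operators, of a single operator of `G`; so their `H`-norms are bounded. -/
theorem exists_norm_le_of_norm_le_geometric {𝕜 : Type} [RCLike 𝕜] {G H : MultiClass 𝕜}
    {NG NH : MultiNorm 𝕜} {p : ℝ}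
    (hG : IsPBanachHyperIdeal 𝕜 G NG p) (hH : IsPNormedHyperIdeal 𝕜 H NH p)
    (hsub : ∀ (n : ℕ) (E : Fin n → Type) [∀ i, NormedAddCommGroup (E i)]
      [∀ i, NormedSpace 𝕜 (E i)] [∀ i, CompleteSpace (E i)]
      (F : Type) [NormedAddCommGroup F] [NormedSpace 𝕜 F] [CompleteSpace F],
      G n E F ⊆ H n E F)
    {n : ℕ} (E : ℕ → Fin n → Type) [∀ k i, NormedAddCommGroup (E k i)]
    [∀ k i, NormedSpace 𝕜 (E k i)] [∀ k i, CompleteSpace (E k i)]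
    (F : ℕ → Type) [∀ k, NormedAddCommGroup (F k)] [∀ k, NormedSpace 𝕜 (F k)]
    [∀ k, CompleteSpace (F k)] (A : ∀ k, ContinuousMultilinearMap 𝕜 (E k) (F k))
    (hA : ∀ k, A k ∈ G n (E k) (F k)) (hN : ∀ k, NG n (E k) (F k) (A k) ≤ (1 / 2) ^ k) :
    ∃ C : ℝ, ∀ k, NH n (E k) (F k) (A k) ≤ C := by
  let πE : ∀ k i, lp (fun k => E k i) ∞ →L[𝕜] E k i := fun k i =>
    lp.evalCLM 𝕜 (fun k => E k i) ∞ k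
  let ιE : ∀ k i, E k i →L[𝕜] lp (fun k => E k i) ∞ := fun k i =>
    lp.singleContinuousLinearMap 𝕜 (fun k => E k i) ∞ k
  have hπE : ∀ k i, ‖πE k i‖ ≤ 1 := fun k i => lp.norm_evalCLM_top_le 𝕜 _ k
  have hιE : ∀ k i, ‖ιE k i‖ ≤ 1 := fun k i => lp.norm_singleContinuousLinearMap_top_le 𝕜 _ k
  let T : ℕ → ContinuousMultilinearMap 𝕜 (fun i => lp (fun k => E k i) ∞) (lp F ∞) := fun k =>
    (lp.singleContinuousLinearMap 𝕜 F ∞ k).compContinuousMultilinearMap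
      ((A k).compContinuousLinearMap (πE k))
  have hT : ∀ k, T k ∈ G n _ _ := fun k => hG.comp_linear_mem _ (hA k) _
  obtain ⟨B, hB, hlim⟩ := hG.exists_tendsto_sum hT fun k =>
    (hG.norm_comp_linear_le (lp.norm_singleContinuousLinearMap_top_le 𝕜 F k) (hA k) (hπE k)).trans (hN k)
  have hsection : ∀ k, (lp.evalCLM 𝕜 F ∞ k).compContinuousMultilinearMap
      (B.compContinuousLinearMap (ιE k)) = A k := by
    intro k
    set B' := (lp.evalCLM 𝕜 F ∞ k).compContinuousMultilinearMap
      (B.compContinuousLinearMap (ιE k)) with hB'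
    have hmem : A k - B' ∈ G n (E k) (F k) := hG.sub_mem (hA k) (hG.comp_linear_mem _ hB _)
    have hle : ∀ m ≥ k + 1, NG n (E k) (F k) (A k - B') ≤
        NG n _ _ (∑ j ∈ Finset.range m, T j - B) := by
      intro m hm
      have heq : A k - B' = (lp.evalCLM 𝕜 F ∞ k).compContinuousMultilinearMap
          ((∑ j ∈ Finset.range m, T j - B).compContinuousLinearMap (ιE k)) := by
        ext x
        have hsum : ∑ j ∈ Finset.range m, lp.evalCLM 𝕜 F ∞ k (T j fun i => ιE k i (x i)) =
            A k x := by
          refine (Finset.sum_eq_single_of_mem k (Finset.mem_range.2 hm)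
            fun j _ hj => lp.evalCLM_singleContinuousLinearMap_of_ne 𝕜 F hj.symm _).trans ?_
          refine (lp.evalCLM_singleContinuousLinearMap_self 𝕜 F k _).trans (congrArg (A k) ?_)
          exact funext fun i => lp.evalCLM_singleContinuousLinearMap_self 𝕜 (fun k => E k i) k (x i)
        simp [hB', ← hsum]
      rw [heq]
      exact hG.norm_comp_linear_le (lp.norm_evalCLM_top_le 𝕜 F k)
        (hG.sub_mem (hG.sum_mem hT m) hB) (hιE k)
    have hzero : NG n (E k) (F k) (A k - B') = 0 :=
      le_antisymm (ge_of_tendsto hlim (eventually_atTop.2 ⟨k + 1, hle⟩))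
        (hG.norm_nonneg' n _ _ _)
    exact (sub_eq_zero.1 ((hG.norm_eq_zero_iff n _ _ hmem).1 hzero)).symm
  refine ⟨NH n _ _ B, fun k => ?_⟩
  conv_lhs => rw [← hsection k]
  exact hH.norm_comp_linear_le (lp.norm_evalCLM_top_le 𝕜 F k) (hsub n _ _ hB) (hιE k)

/-- If `(G, NG)` and `(H, NH)` are `p`-Banach hyper-ideals with `G ⊆ H`, then for every
`n` there is a constant `C`, depending only on `n`, with `‖A‖_H ≤ C ‖A‖_G` for every
`n`-linear `A ∈ G`. -/
theorem smaller_pBanach_hyperIdeal_norm_estimate (G H : MultiClass 𝕜)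
    (NG NH : MultiNorm 𝕜) (p : ℝ)
    (hG : IsPBanachHyperIdeal 𝕜 G NG p) (hH : IsPBanachHyperIdeal 𝕜 H NH p)
    (hsub : ∀ (n : ℕ) (E : Fin n → Type) [∀ i, NormedAddCommGroup (E i)]
      [∀ i, NormedSpace 𝕜 (E i)] [∀ i, CompleteSpace (E i)]
      (F : Type) [NormedAddCommGroup F] [NormedSpace 𝕜 F] [CompleteSpace F],
      G n E F ⊆ H n E F) :
    ∀ n : ℕ, ∃ C : ℝ, ∀ (E : Fin n → Type) [∀ i, NormedAddCommGroup (E i)]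
      [∀ i, NormedSpace 𝕜 (E i)] [∀ i, CompleteSpace (E i)]
      (F : Type) [NormedAddCommGroup F] [NormedSpace 𝕜 F] [CompleteSpace F]
      (A : ContinuousMultilinearMap 𝕜 E F), A ∈ G n E F →
      NH n E F A ≤ C * NG n E F A := by
  intro n
  by_contra! hcon
  choose E iE iE' iE'' F iF iF' iF'' A hA hlt using fun k : ℕ => hcon (k * 2 ^ k)
  have hpos : ∀ k, 0 < NG n (E k) (F k) (A k) := fun k => by
    refine (hG.norm_nonneg' n _ _ _).lt_of_ne' fun h0 => ?_
    have hNH := (hH.norm_eq_zero_iff n _ _ (hsub n _ _ (hA k))).2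
      ((hG.norm_eq_zero_iff n _ _ (hA k)).1 h0)
    simpa [h0, hNH] using hlt k
  let c : ℕ → ℝ := fun k => (1 / 2) ^ k / NG n (E k) (F k) (A k)
  have hc : ∀ k, ‖(c k : 𝕜)‖ = c k := fun k =>
    RCLike.norm_of_nonneg (div_nonneg (by positivity) (hpos k).le)
  obtain ⟨C, hC⟩ := exists_norm_le_of_norm_le_geometric hG hH.toIsPNormedHyperIdeal hsub E F
    (fun k => (c k : 𝕜) • A k) (fun k => hG.smul_mem n _ _ _ (hA k)) fun k => by
      rw [hG.norm_smul n _ _ _ (hA k), hc]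
      exact (div_mul_cancel₀ _ (hpos k).ne').le
  obtain ⟨k, hk⟩ := exists_nat_ge C
  refine absurd (hC k) (not_le.2 (hk.trans_lt ?_))
  rw [hH.norm_smul n _ _ _ (hsub n _ _ (hA k)), hc]
  have hck : 0 < c k := div_pos (by positivity) (hpos k)
  calc (k : ℝ) = c k * (k * 2 ^ k * NG n (E k) (F k) (A k)) := by
        have := (hpos k).ne'
        simp only [c, one_div, inv_pow]
        field_simp
    _ < c k * NH n (E k) (F k) (A k) := mul_lt_mul_of_pos_left (hlt k) hck

end
end

section
/- The bilinear form T : ℓ2 × ℓ2 → 𝕂 defined by T((x_i)_i,(y_i)_i) = Σ_{i=1}^∞ x_i y_i is continuous, and T does not belong to the closure, in the operator norm of L(²ℓ2;𝕂), of the linear span of the bilinear forms of finite type, i.e., of the set of forms (x,y) ↦ φ(x)ψ(y) with φ, ψ continuous linear functionals on ℓ2. In particular, T is not of finite type. -/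
open Filter Topology
open scoped ENNReal NNReal BigOperators

noncomputable section

variable (𝕜 : Type) [RCLike 𝕜]

/-- The continuous bilinear form `(x, y) ↦ B x y`, as a continuous multilinear map on pairs. -/
def ContinuousLinearMap.toContinuousMultilinearMapFinTwo {E F : Type*} [NormedAddCommGroup E]
    [NormedSpace 𝕜 E] [NormedAddCommGroup F] [NormedSpace 𝕜 F] (B : E →L[𝕜] E →L[𝕜] F) :
    ContinuousMultilinearMap 𝕜 (fun _ : Fin 2 => E) F where
  toFun v := B (v 0) (v 1)
  map_update_add' v i x y := by
    fin_cases i <;> simp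
  map_update_smul' v i c x := by
    fin_cases i <;> simp
  cont := by fun_prop

/-- The scalar product `(x, y) ↦ ∑ xᵢ yᵢ` on `ℓ₂` is a continuous bilinear form. -/
theorem exists_continuousMultilinearMap_scalarProduct :
    ∃ T : ContinuousMultilinearMap 𝕜 (fun _ : Fin 2 => lp (fun _ : ℕ => 𝕜) 2) 𝕜,
      ∀ v, T v = ∑' i : ℕ, v 0 i * v 1 i :=
  ⟨ContinuousLinearMap.toContinuousMultilinearMapFinTwo 𝕜
    (lp.dualPairing 2 2 (fun _ : ℕ => ContinuousLinearMap.mul 𝕜 𝕜) (K := 1) (by simp)),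
    fun _ => rfl⟩

variable {𝕜}

/-- Continuous linear functionals on `ℓ₂` tend to zero along the unit vectors. -/
theorem tendsto_apply_single_zero (φ : lp (fun _ : ℕ => 𝕜) 2 →L[𝕜] 𝕜) :
    Tendsto (fun n => φ (lp.single 2 n 1)) atTop (𝓝 0) := by
  obtain ⟨a, rfl⟩ := (InnerProductSpace.toDual 𝕜 (lp (fun _ : ℕ => 𝕜) 2)).surjective φ
  have h := (lp.summable_inner (𝕜 := 𝕜) a a).norm.tendsto_atTop_zero
  have h' : Tendsto (fun n => ‖a n‖ ^ 2) atTop (𝓝 0) := by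
    simpa [-inner_self_eq_norm_sq_to_K, ← sq] using h
  rw [tendsto_zero_iff_norm_tendsto_zero]
  simpa [InnerProductSpace.toDual_apply_apply, lp.inner_single_right] using h'.sqrt

/-- Bilinear forms of finite type on `ℓ₂` tend to zero along the diagonal of the unit vectors. -/
theorem IsFiniteType.tendsto_apply_single_zero
    {B : ContinuousMultilinearMap 𝕜 (fun _ : Fin 2 => lp (fun _ : ℕ => 𝕜) 2) 𝕜}
    (hB : IsFiniteType 𝕜 B) :
    Tendsto (fun n => B fun _ => lp.single 2 n 1) atTop (𝓝 0) := by
  refine Submodule.span_induction ?_ ?_ ?_ ?_ hB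
  · rintro B ⟨φ, y, hφ⟩
    simpa [hφ] using
      ((_root_.tendsto_apply_single_zero (φ 0)).mul
        (_root_.tendsto_apply_single_zero (φ 1))).mul_const y
  · simp
  · intro B C _ _ hB hC
    simpa using hB.add hC
  · intro c B _ hB
    simpa using hB.const_mul c

/-- The limit along the diagonal of the unit vectors remains zero in the operator-norm closure
of the bilinear forms of finite type. -/
theorem tendsto_apply_single_zero_of_mem_closure
    {T : ContinuousMultilinearMap 𝕜 (fun _ : Fin 2 => lp (fun _ : ℕ => 𝕜) 2) 𝕜}
    (hT : T ∈ closure {B | IsFiniteType 𝕜 B}) :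
    Tendsto (fun n => T fun _ => lp.single 2 n 1) atTop (𝓝 0) := by
  rw [Metric.tendsto_nhds]
  intro ε hε
  obtain ⟨B, hB, hTB⟩ := Metric.mem_closure_iff.1 hT (ε / 2) (half_pos hε)
  filter_upwards [Metric.tendsto_nhds.1 (IsFiniteType.tendsto_apply_single_zero hB) (ε / 2)
    (half_pos hε)] with n hn
  have h : ‖(T - B) fun _ => lp.single 2 n 1‖ ≤ ‖T - B‖ := by
    simpa [lp.norm_single] using (T - B).le_opNorm fun _ => lp.single 2 n 1
  rw [sub_apply, ← dist_eq_norm, ← dist_eq_norm] at h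
  linarith [dist_triangle (T fun _ => lp.single 2 n 1) (B fun _ => lp.single 2 n 1) 0]

variable (𝕜)

/-- The scalar product `T((x_i)_i, (y_i)_i) = ∑ x_i y_i` is a continuous bilinear form
on `ℓ₂ × ℓ₂` which does not lie in the operator-norm closure of the bilinear forms of
finite type; in particular it is not of finite type. -/
theorem scalarProduct_not_approximable_by_finiteType :
    (∃ T : ContinuousMultilinearMap 𝕜 (fun _ : Fin 2 => lp (fun _ : ℕ => 𝕜) 2) 𝕜,
      ∀ v, T v = ∑' i : ℕ, v 0 i * v 1 i) ∧
    ∀ T : ContinuousMultilinearMap 𝕜 (fun _ : Fin 2 => lp (fun _ : ℕ => 𝕜) 2) 𝕜,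
      (∀ v, T v = ∑' i : ℕ, v 0 i * v 1 i) →
      T ∉ closure {B : ContinuousMultilinearMap 𝕜 (fun _ : Fin 2 => lp (fun _ : ℕ => 𝕜) 2) 𝕜 |
          IsFiniteType 𝕜 B} ∧ ¬ IsFiniteType 𝕜 T := by
  refine ⟨exists_continuousMultilinearMap_scalarProduct 𝕜, fun T hT => ?_⟩
  have hclosure : T ∉ closure {B | IsFiniteType 𝕜 B} := by
    intro h
    have hdiag : ∀ n, (T fun _ => lp.single 2 n 1) = 1 := fun n => by
      rw [hT, tsum_eq_single n] <;> simp +contextual [lp.single_apply]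
    have hlim := tendsto_apply_single_zero_of_mem_closure h
    simp only [hdiag] at hlim
    exact one_ne_zero (tendsto_nhds_unique tendsto_const_nhds hlim)
  exact ⟨hclosure, fun h => hclosure (subset_closure h)⟩

end
end

section
/- The class L_F of finite-rank continuous multilinear operators between Banach spaces (those A whose range spans a finite-dimensional subspace of the target space), endowed with the operator norm, is the smallest normed hyper-ideal: (L_F,‖·‖) is a normed hyper-ideal, and for every normed hyper-ideal (H,‖·‖_H) one has L_F ⊆ H (every finite-rank continuous multilinear operator belongs to the corresponding component of H) and ‖A‖ ≤ ‖A‖_H for every A ∈ H. -/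
open Filter Topology
open scoped ENNReal NNReal BigOperators

noncomputable section

variable (𝕜 : Type) [RCLike 𝕜]

/-- The finite-rank multilinear operators. -/
def finRankClass : MultiClass 𝕜 := by
  intro n E _ _ _ F _ _ _
  exact {A | IsFiniteRank 𝕜 A}

section Helpers

variable {𝕜}
variable {n : ℕ} {E : Fin n → Type} [∀ i, NormedAddCommGroup (E i)] [∀ i, NormedSpace 𝕜 (E i)]
  {F : Type} [NormedAddCommGroup F] [NormedSpace 𝕜 F]

theorem update_comp_subtype_mk {ι : Type*} {X : ι → Type*} [DecidableEq ι] {p : ι → Prop}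
    [DecidableEq {j // p j}] (hp : ∀ j, p j) (x : ∀ j : {j // p j}, X j.1) (i : {j // p j})
    (c : X i.1) :
    (fun j => Function.update x i c ⟨j, hp j⟩) =
      Function.update (fun j => x ⟨j, hp j⟩) i.1 c := by
  ext j
  by_cases h : j = i.1
  · subst h; simp
  · rw [Function.update_of_ne h, Function.update_of_ne fun h' => h (congrArg Subtype.val h')]

/-- A continuous multilinear map, seen as a map of the variables indexed by a subtype which
contains every index. -/
def ContinuousMultilinearMap.domSubtypeOfForall (A : ContinuousMultilinearMap 𝕜 E F)
    {p : Fin n → Prop} (hp : ∀ j, p j) :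
    ContinuousMultilinearMap 𝕜 (fun j : {j : Fin n // p j} => E j.1) F where
  toFun x := A fun j => x ⟨j, hp j⟩
  map_update_add' := by
    intro _ x i a b
    simp only [update_comp_subtype_mk hp, A.map_update_add]
  map_update_smul' := by
    intro _ x i c a
    simp only [update_comp_subtype_mk hp, A.map_update_smul]
  cont := A.cont.comp <| continuous_pi fun _ => continuous_apply _

theorem IsFiniteRank.of_forall_mem {A : ContinuousMultilinearMap 𝕜 E F} (V : Submodule 𝕜 F)
    [FiniteDimensional 𝕜 V] (h : ∀ x, A x ∈ V) : IsFiniteRank 𝕜 A :=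
  Submodule.finiteDimensional_of_le (S₂ := V) <|
    Submodule.span_le.2 <| Set.range_subset_iff.2 h

theorem apply_mem_span_range (A : ContinuousMultilinearMap 𝕜 E F) (x : ∀ i, E i) :
    A x ∈ Submodule.span 𝕜 (Set.range A) :=
  Submodule.subset_span ⟨x, rfl⟩

theorem IsFiniteRank.zero : IsFiniteRank 𝕜 (0 : ContinuousMultilinearMap 𝕜 E F) :=
  .of_forall_mem ⊥ fun _ => rfl

theorem IsFiniteRank.add {A B : ContinuousMultilinearMap 𝕜 E F} (hA : IsFiniteRank 𝕜 A)
    (hB : IsFiniteRank 𝕜 B) : IsFiniteRank 𝕜 (A + B) := by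
  unfold IsFiniteRank at hA hB
  exact .of_forall_mem (Submodule.span 𝕜 (Set.range A) ⊔ Submodule.span 𝕜 (Set.range B)) fun x =>
    Submodule.add_mem_sup (apply_mem_span_range A x) (apply_mem_span_range B x)

theorem IsFiniteRank.smul {A : ContinuousMultilinearMap 𝕜 E F} (hA : IsFiniteRank 𝕜 A) (c : 𝕜) :
    IsFiniteRank 𝕜 (c • A) := by
  unfold IsFiniteRank at hA
  exact .of_forall_mem (Submodule.span 𝕜 (Set.range A)) fun x =>
    Submodule.smul_mem _ c (apply_mem_span_range A x)

theorem IsFiniteType.isFiniteRank {A : ContinuousMultilinearMap 𝕜 E F} (hA : IsFiniteType 𝕜 A) :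
    IsFiniteRank 𝕜 A := by
  induction hA using Submodule.span_induction with
  | mem B hB =>
    obtain ⟨φ, y, hB⟩ := hB
    exact .of_forall_mem (Submodule.span 𝕜 {y}) fun x => by
      rw [hB]
      exact Submodule.smul_mem _ _ (Submodule.mem_span_singleton_self y)
  | zero => exact .zero
  | add _ _ _ _ hA hB => exact hA.add hB
  | smul c _ _ hA => exact hA.smul c

theorem isFiniteType_mkPiAlgebra (n : ℕ) :
    IsFiniteType 𝕜 (ContinuousMultilinearMap.mkPiAlgebra 𝕜 (Fin n) 𝕜) :=
  Submodule.subset_span ⟨fun _ => ContinuousLinearMap.id 𝕜 𝕜, 1, fun x => by simp⟩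

theorem isFiniteType_of_isEmpty [IsEmpty (Fin n)] (A : ContinuousMultilinearMap 𝕜 E F) :
    IsFiniteType 𝕜 A :=
  Submodule.subset_span ⟨fun _ => 0, A isEmptyElim, fun x => by
    simp [Subsingleton.elim x isEmptyElim]⟩

theorem isFiniteType_ofSubsingleton_id (V : Type) [NormedAddCommGroup V] [NormedSpace 𝕜 V]
    [FiniteDimensional 𝕜 V] :
    IsFiniteType 𝕜 (ContinuousMultilinearMap.ofSubsingleton 𝕜 V V (0 : Fin 1)
      (ContinuousLinearMap.id 𝕜 V)) := by
  let b := Module.finBasis 𝕜 V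
  have key : ContinuousMultilinearMap.ofSubsingleton 𝕜 V V (0 : Fin 1)
      (ContinuousLinearMap.id 𝕜 V) =
      ∑ k, ContinuousMultilinearMap.ofSubsingleton 𝕜 V V (0 : Fin 1)
        ((LinearMap.toContinuousLinearMap (b.coord k)).smulRight (b k)) := by
    ext x
    simp
  unfold IsFiniteType
  rw [key]
  exact Submodule.sum_mem _ fun k _ => Submodule.subset_span
    ⟨fun _ => LinearMap.toContinuousLinearMap (b.coord k), b k, fun x => by simp⟩

section BlockComp

variable {M : ℕ} {G : Fin M → Type} [∀ j, NormedAddCommGroup (G j)] [∀ j, NormedSpace 𝕜 (G j)]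
  {H0 : Type} [NormedAddCommGroup H0] [NormedSpace 𝕜 H0] {f : Fin M → Fin n}
  {B : ∀ i : Fin n, ContinuousMultilinearMap 𝕜 (fun j : {j : Fin M // f j = i} => G j.1) (E i)}
  {A : ContinuousMultilinearMap 𝕜 E F} {t : F →L[𝕜] H0} {C : ContinuousMultilinearMap 𝕜 G H0}

theorem IsFiniteRank.of_isBlockComp (hA : IsFiniteRank 𝕜 A) (h : IsBlockComp 𝕜 f B A t C) :
    IsFiniteRank 𝕜 C := by
  unfold IsFiniteRank at hA
  exact .of_forall_mem ((Submodule.span 𝕜 (Set.range A)).map t.toLinearMap) fun x => by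
    rw [h x]
    exact Submodule.mem_map_of_mem (apply_mem_span_range A _)

theorem IsBlockComp.norm_le (h : IsBlockComp 𝕜 f B A t C) :
    ‖C‖ ≤ ‖t‖ * ‖A‖ * ∏ i, ‖B i‖ := by
  refine C.opNorm_le_bound (by positivity) fun x => ?_
  calc ‖C x‖ = ‖t (A fun i => B i fun j => x j.1)‖ := by rw [h x]
    _ ≤ ‖t‖ * (‖A‖ * ∏ i, (‖B i‖ * ∏ j : {j : Fin M // f j = i}, ‖x j.1‖)) := by
      refine t.le_opNorm_of_le (A.le_opNorm_mul_prod_of_le fun i => ?_)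
      exact (B i).le_opNorm fun j => x j.1
    _ = ‖t‖ * ‖A‖ * (∏ i, ‖B i‖) * ∏ j, ‖x j‖ := by
      rw [Finset.prod_mul_distrib, Fintype.prod_fiberwise f fun j => ‖x j‖]
      ring

end BlockComp

theorem isPNormedHyperIdeal_finRankClass :
    IsPNormedHyperIdeal 𝕜 (finRankClass 𝕜) (opMultiNorm 𝕜) 1 where
  zero_mem _ _ _ _ _ _ _ _ _ := IsFiniteRank.zero
  add_mem _ _ _ _ _ _ _ _ _ _ _ hA hB := IsFiniteRank.add hA hB
  smul_mem _ _ _ _ _ _ _ _ _ c _ hA := IsFiniteRank.smul hA c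
  comp_mem := by
    intro n M G _ _ _ E _ _ _ F H0 _ _ _ _ _ _ f _ _ B A hA t C h
    exact IsFiniteRank.of_isBlockComp hA h
  finiteType_mem _ _ _ _ _ _ _ _ _ _ hA := hA.isFiniteRank
  p_pos := one_pos
  p_le_one := le_rfl
  norm_nonneg' _ _ _ _ _ _ _ _ _ A := norm_nonneg A
  norm_eq_zero_iff _ _ _ _ _ _ _ _ _ _ _ := norm_eq_zero
  norm_smul _ _ _ _ _ _ _ _ _ c A _ := _root_.norm_smul c A
  norm_add_le _ _ _ _ _ _ _ _ _ A B _ _ := by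
    simp only [Real.rpow_one]
    exact _root_.norm_add_le A B
  norm_In _ := ContinuousMultilinearMap.norm_mkPiAlgebra
  norm_comp_le := by
    intro n M G _ _ _ E _ _ _ F H0 _ _ _ _ _ _ f _ _ B A _ t C h
    exact h.norm_le

variable {H : MultiClass 𝕜} [∀ i, CompleteSpace (E i)] [CompleteSpace F]

theorem IsHyperIdeal.mem_of_isFiniteRank (hH : IsHyperIdeal 𝕜 H)
    {A : ContinuousMultilinearMap 𝕜 E F} (hA : IsFiniteRank 𝕜 A) : A ∈ H n E F := by
  rcases isEmpty_or_nonempty (Fin n) with hn | ⟨⟨i₀⟩⟩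
  · exact hH.finiteType_mem _ _ _ _ (isFiniteType_of_isEmpty A)
  let V := Submodule.span 𝕜 (Set.range A)
  have : FiniteDimensional 𝕜 V := hA
  have : CompleteSpace V := FiniteDimensional.complete 𝕜 V
  exact hH.comp_mem 1 n E (fun _ => V) V F (fun _ => 0) monotone_const
    (fun i => ⟨i₀, Subsingleton.elim _ _⟩)
    (fun i => (A.codRestrict V (apply_mem_span_range A)).domSubtypeOfForall
      fun _ => Subsingleton.elim _ _)
    (ContinuousMultilinearMap.ofSubsingleton 𝕜 V V (0 : Fin 1) (ContinuousLinearMap.id 𝕜 V))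
    (hH.finiteType_mem _ _ _ _ (isFiniteType_ofSubsingleton_id V)) V.subtypeL A fun _ => rfl

theorem IsPNormedHyperIdeal.norm_le {Nm : MultiNorm 𝕜} {p : ℝ}
    (hH : IsPNormedHyperIdeal 𝕜 H Nm p) {A : ContinuousMultilinearMap 𝕜 E F}
    (hA : A ∈ H n E F) : ‖A‖ ≤ Nm n E F A := by
  have hN := hH.norm_nonneg' n E F A
  refine A.opNorm_le_bound hN fun x => ?_
  obtain ⟨t, ht, htx⟩ := exists_dual_vector'' 𝕜 (A x)
  have hI := hH.finiteType_mem _ _ _ _ (isFiniteType_mkPiAlgebra (𝕜 := 𝕜) n)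
  have hsub : ∀ i : Fin n, Subsingleton {j : Fin n // id j = i} := fun i =>
    ⟨fun j k => Subtype.ext (j.2.trans k.2.symm)⟩
  let B : ∀ i : Fin n, ContinuousMultilinearMap 𝕜 (fun _ : {j : Fin n // id j = i} => 𝕜) (E i) :=
    fun i => ContinuousMultilinearMap.ofSubsingleton 𝕜 𝕜 (E i) ⟨i, rfl⟩
      (ContinuousLinearMap.toSpanSingleton 𝕜 (x i))
  have hcomp : IsBlockComp 𝕜 id B A t
      ((‖A x‖ : 𝕜) • ContinuousMultilinearMap.mkPiAlgebra 𝕜 (Fin n) 𝕜) := by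
    intro c
    have : A (fun i => B i fun j => c j.1) = (∏ i, c i) • A x := A.map_smul_univ c x
    rw [this, map_smul, htx]
    simp [mul_comm]
  have hle := hH.norm_comp_le n n (fun _ => 𝕜) E F 𝕜 id monotone_id Function.surjective_id B A hA
    t _ hcomp
  have hB : ∀ i, ‖B i‖ = ‖x i‖ := fun i => by
    rw [ContinuousMultilinearMap.norm_ofSubsingleton, ContinuousLinearMap.norm_toSpanSingleton]
  rw [hH.norm_smul _ _ _ _ hI, hH.norm_In, mul_one, RCLike.norm_ofReal, abs_norm] at hle
  simp only [hB] at hle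
  refine hle.trans ?_
  gcongr
  exact mul_le_of_le_one_left hN ht

end Helpers

/-- The class of finite-rank continuous multilinear operators with the uniform norm is
the smallest normed hyper-ideal. -/
theorem finRank_smallest_normed_hyperIdeal :
    IsPNormedHyperIdeal 𝕜 (finRankClass 𝕜) (opMultiNorm 𝕜) 1 ∧
    ∀ (H : MultiClass 𝕜) (Nm : MultiNorm 𝕜), IsPNormedHyperIdeal 𝕜 H Nm 1 →
      (∀ (n : ℕ) (E : Fin n → Type) [∀ i, NormedAddCommGroup (E i)]
      [∀ i, NormedSpace 𝕜 (E i)] [∀ i, CompleteSpace (E i)]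
      (F : Type) [NormedAddCommGroup F] [NormedSpace 𝕜 F] [CompleteSpace F]
        (A : ContinuousMultilinearMap 𝕜 E F), IsFiniteRank 𝕜 A → A ∈ H n E F) ∧
      (∀ (n : ℕ) (E : Fin n → Type) [∀ i, NormedAddCommGroup (E i)]
      [∀ i, NormedSpace 𝕜 (E i)] [∀ i, CompleteSpace (E i)]
      (F : Type) [NormedAddCommGroup F] [NormedSpace 𝕜 F] [CompleteSpace F]
        (A : ContinuousMultilinearMap 𝕜 E F), A ∈ H n E F → ‖A‖ ≤ Nm n E F A) := by
  refine ⟨isPNormedHyperIdeal_finRankClass, fun H Nm hH => ⟨?_, ?_⟩⟩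
  · intro n E _ _ _ F _ _ _ A hA
    exact hH.toIsHyperIdeal.mem_of_isFiniteRank hA
  · intro n E _ _ _ F _ _ _ A hA
    exact hH.norm_le hA

end
end

section
/- The continuous bilinear form T : ℓ2 × ℓ2 → 𝕂, T((x_i)_i,(y_i)_i) = Σ_{i=1}^∞ x_i y_i, is not nuclear: there exist no sequence (λ_j)_{j=1}^∞ ∈ ℓ1 and bounded sequences (φ_j)_{j=1}^∞, (ψ_j)_{j=1}^∞ of continuous linear functionals on ℓ2 such that T(x,y) = Σ_{j=1}^∞ λ_j φ_j(x)ψ_j(y) for all x, y ∈ ℓ2. (Since T is trivially hyper-nuclear, this shows that the class of nuclear multilinear operators is strictly contained in the class of hyper-nuclear multilinear operators.) -/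
open Filter Topology
open scoped ENNReal NNReal BigOperators

noncomputable section

variable (𝕜 : Type) [RCLike 𝕜]

/-- A finite orthonormal family tests the product of two functionals boundedly. -/
lemma Orthonormal.norm_sum_apply_mul_apply_le {𝕜 H ι : Type*} [RCLike 𝕜]
    [NormedAddCommGroup H] [InnerProductSpace 𝕜 H] [CompleteSpace H] {e : ι → H}
    (he : Orthonormal 𝕜 e) (s : Finset ι) (φ ψ : H →L[𝕜] 𝕜) :
    ‖∑ k ∈ s, φ (e k) * ψ (e k)‖ ≤ ‖φ‖ ^ 2 + ‖ψ‖ ^ 2 := by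
  have bessel (χ : H →L[𝕜] 𝕜) : ∑ k ∈ s, ‖χ (e k)‖ ^ 2 ≤ ‖χ‖ ^ 2 := by
    have h := he.sum_inner_products_le ((InnerProductSpace.toDual 𝕜 H).symm χ) (s := s)
    simpa only [norm_inner_symm (e _), InnerProductSpace.toDual_symm_apply,
      LinearIsometryEquiv.norm_map] using h
  calc ‖∑ k ∈ s, φ (e k) * ψ (e k)‖ ≤ ∑ k ∈ s, (‖φ (e k)‖ ^ 2 + ‖ψ (e k)‖ ^ 2) := by
        refine norm_sum_le_of_le s fun k _ => ?_
        rw [norm_mul]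
        nlinarith [sq_nonneg (‖φ (e k)‖ - ‖ψ (e k)‖), sq_nonneg (‖φ (e k)‖ + ‖ψ (e k)‖)]
    _ ≤ ‖φ‖ ^ 2 + ‖ψ‖ ^ 2 := by
        rw [Finset.sum_add_distrib]
        exact add_le_add (bessel φ) (bessel ψ)

/-- The standard unit vectors of `ℓ²` are orthonormal. -/
lemma lp.orthonormal_single_one {𝕜 ι : Type*} [RCLike 𝕜] [DecidableEq ι] :
    Orthonormal 𝕜 (fun k : ι => lp.single (E := fun _ : ι => 𝕜) 2 k 1) := by
  rw [orthonormal_iff_ite]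
  intro i j
  rw [lp.inner_single_left]
  simp [lp.single_apply, Pi.single_apply]

/-- The scalar product on `ℓ²`, expressed through the inner product. -/
lemma lp.inner_star_eq_tsum_mul {𝕜 ι : Type*} [RCLike 𝕜] (x y : lp (fun _ : ι => 𝕜) 2) :
    inner 𝕜 (star x) y = ∑' i, x i * y i := by
  simp [lp.inner_eq_tsum, mul_comm]

/-- The scalar product on `ℓ²` as a continuous bilinear form. -/
def lp.scalarProduct (𝕜 ι : Type*) [RCLike 𝕜] :
    ContinuousMultilinearMap 𝕜 (fun _ : Fin 2 => lp (fun _ : ι => 𝕜) 2) 𝕜 where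
  toFun v := inner 𝕜 (star (v 0)) (v 1)
  map_update_add' v i x y := by
    fin_cases i <;> simp [inner_add_left, inner_add_right]
  map_update_smul' v i c x := by
    fin_cases i <;> simp [inner_smul_left, inner_smul_right]
  cont := by fun_prop

/-- The scalar product `T((x_i)_i, (y_i)_i) = ∑ x_i y_i` on `ℓ₂ × ℓ₂` is a continuous
bilinear form admitting no nuclear representation. -/
theorem scalarProduct_not_nuclear :
    (∃ T : ContinuousMultilinearMap 𝕜 (fun _ : Fin 2 => lp (fun _ : ℕ => 𝕜) 2) 𝕜,
      ∀ v, T v = ∑' i : ℕ, v 0 i * v 1 i) ∧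
    ∀ T : ContinuousMultilinearMap 𝕜 (fun _ : Fin 2 => lp (fun _ : ℕ => 𝕜) 2) 𝕜,
      (∀ v, T v = ∑' i : ℕ, v 0 i * v 1 i) →
      ¬ ∃ (lam : ℕ → 𝕜) (φ ψ : ℕ → (lp (fun _ : ℕ => 𝕜) 2 →L[𝕜] 𝕜)),
          Summable (fun j => ‖lam j‖) ∧ (∃ c, ∀ j, ‖φ j‖ ≤ c) ∧ (∃ c, ∀ j, ‖ψ j‖ ≤ c) ∧
          ∀ x y : lp (fun _ : ℕ => 𝕜) 2,
            HasSum (fun j => lam j * φ j x * ψ j y) (T ![x, y]) := by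
  refine ⟨⟨lp.scalarProduct 𝕜 ℕ, fun v => lp.inner_star_eq_tsum_mul (v 0) (v 1)⟩, ?_⟩
  rintro T hT ⟨lam, φ, ψ, hlam, ⟨c, hc⟩, ⟨d, hd⟩, hsum⟩
  let e : ℕ → lp (fun _ : ℕ => 𝕜) 2 := fun k => lp.single 2 k 1
  have he : Orthonormal 𝕜 e := lp.orthonormal_single_one
  have hTe (k : ℕ) : T ![e k, e k] = 1 := by
    rw [hT, tsum_eq_single k]
    · simp [e]
    · intro i hi
      simp [e, lp.single_apply, hi]
  have hN (N : ℕ) : (N : ℝ) ≤ ∑' j, ‖lam j‖ * (c ^ 2 + d ^ 2) := by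
    have h := hasSum_sum (s := Finset.range N) fun k _ => hsum (e k) (e k)
    simp only [hTe, Finset.sum_const, Finset.card_range, nsmul_eq_mul, mul_one, mul_assoc,
      ← Finset.mul_sum] at h
    rw [← RCLike.norm_natCast (K := 𝕜) N, ← h.tsum_eq]
    refine tsum_of_norm_bounded (hlam.mul_right _).hasSum fun j => ?_
    rw [norm_mul]
    gcongr
    refine (he.norm_sum_apply_mul_apply_le _ (φ j) (ψ j)).trans ?_
    gcongr
    exacts [hc j, hd j]
  obtain ⟨N, hlt⟩ := exists_nat_gt (∑' j, ‖lam j‖ * (c ^ 2 + d ^ 2))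
  exact (hN N).not_gt hlt

end
end
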